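/- arXiv:2604.10670 — 11 statements merged into one kernel-verified Lean document; each statement's English description precedes it below -/
import Mathlib

section
/- Let Ω be a Borel subset of ℝⁿ and let C ⊆ closure(Ω) be a nonempty closed set with λ(C ∩ Ω) = 0. Then there exists a density measure at C on Ω if and only if λ(C_δ ∩ Ω) > 0 for every δ > 0. Moreover, if E ⊆ Ω is a Borel set with λ(C_δ ∩ E) > 0 for every δ > 0, then there exists a density measure μ at C on Ω with μ(Ω \ E) = 0. -/
open MeasureTheory Metric Set Filter Topology

noncomputable section

abbrev Eucl (n : ℕ) : Type := EuclideanSpace ℝ (Fin n)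

/-- A finitely additive measure on the Borel subsets of `Ω`. -/
def IsFinAddOn {n : ℕ} (Ω : Set (Eucl n)) (μ : Set (Eucl n) → ℝ) : Prop :=
  μ ∅ = 0 ∧
  ∀ A B : Set (Eucl n), MeasurableSet A → MeasurableSet B → A ⊆ Ω → B ⊆ Ω →
    Disjoint A B → μ (A ∪ B) = μ A + μ B

/-- `μ` is a density measure at `C` on `Ω`: a nonnegative finitely additive measure on
the Borel subsets of `Ω`, vanishing on Lebesgue null sets, with
`μ (C_δ ∩ Ω) = μ Ω = 1` for all `δ > 0`. -/
def IsDensityMeasureAt {n : ℕ} (Ω C : Set (Eucl n)) (μ : Set (Eucl n) → ℝ) : Prop :=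
  IsFinAddOn Ω μ ∧
  (∀ A : Set (Eucl n), MeasurableSet A → A ⊆ Ω → 0 ≤ μ A) ∧
  (∀ A : Set (Eucl n), MeasurableSet A → A ⊆ Ω → volume A = 0 → μ A = 0) ∧
  μ Ω = 1 ∧
  ∀ δ : ℝ, 0 < δ → μ (thickening δ C ∩ Ω) = 1

/-- If every neighbourhood of `C` meets `E` in positive measure, some ultrafilter contains all
neighbourhoods `thickening δ C` and all sets that are conull in `E`. -/
theorem exists_ultrafilter_thickening_ae {X : Type*} [PseudoEMetricSpace X] [MeasurableSpace X]
    (ν : Measure X) (C E : Set X) (hE : MeasurableSet E)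
    (h : ∀ δ : ℝ, 0 < δ → 0 < ν (thickening δ C ∩ E)) :
    ∃ U : Ultrafilter X, (U : Filter X) ≤ ae (ν.restrict E) ∧
      ∀ δ : ℝ, 0 < δ → thickening δ C ∈ U := by
  have hne : (comap (fun x => infEDist x C) (𝓝 0) ⊓ ae (ν.restrict E)).NeBot := by
    rw [inf_neBot_iff]
    intro s hs t ht
    obtain ⟨ε, hε, hεs⟩ := (ENNReal.nhds_zero_basis.comap _).mem_iff.1 hs
    obtain ⟨δ, hδ, hδ0, hδε⟩ := ENNReal.lt_iff_exists_real_btwn.1 hε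
    by_contra hst
    have hsub : thickening δ C ⊆ tᶜ := fun x hx hxt =>
      hst ⟨x, hεs (lt_trans (mem_thickening_iff_infEDist_lt.1 hx) hδε), hxt⟩
    have hnull : ν.restrict E (thickening δ C) = 0 :=
      measure_mono_null hsub (mem_ae_iff.1 ht)
    rw [Measure.restrict_apply' hE] at hnull
    exact (h δ (ENNReal.ofReal_pos.1 hδ0)).ne' hnull
  obtain ⟨U, hU⟩ := Ultrafilter.exists_le (comap (fun x => infEDist x C) (𝓝 0) ⊓ ae (ν.restrict E))
  refine ⟨U, hU.trans inf_le_right, fun δ hδ => hU.trans inf_le_left ?_⟩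
  exact preimage_mem_comap (Iio_mem_nhds (ENNReal.ofReal_pos.2 hδ))

open scoped Classical in
/-- The zero-one measure of an ultrafilter that contains the neighbourhoods of `C` and the sets
conull in `E ⊆ Ω` is a density measure concentrated on `E`. -/
theorem exists_isDensityMeasureAt_of_subset {n : ℕ} (Ω C E : Set (Eucl n))
    (hE : MeasurableSet E) (hEΩ : E ⊆ Ω)
    (h : ∀ δ : ℝ, 0 < δ → 0 < volume (thickening δ C ∩ E)) :
    ∃ μ : Set (Eucl n) → ℝ, IsDensityMeasureAt Ω C μ ∧ μ (Ω \ E) = 0 := by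
  obtain ⟨U, hU, hUC⟩ := exists_ultrafilter_thickening_ae volume C E hE h
  have hEU : E ∈ U := hU (self_mem_ae_restrict hE)
  have hΩU : Ω ∈ U := mem_of_superset hEU hEΩ
  have hdisj : ∀ A B : Set (Eucl n), Disjoint A B → A ∈ U → B ∉ U := fun A B hAB hA hB =>
    U.empty_notMem (hAB.inter_eq ▸ inter_mem hA hB)
  refine ⟨fun A => if A ∈ U then 1 else 0, ⟨⟨?_, ?_⟩, ?_, ?_, ?_, ?_⟩, ?_⟩
  · simp
  · intro A B _ _ _ _ hAB
    have hAB' := hdisj A B hAB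
    simp only [Ultrafilter.union_mem_iff]
    by_cases hA : A ∈ U <;> by_cases hB : B ∈ U <;> simp_all
  · intro A _ _
    positivity
  · intro A _ _ hA
    refine if_neg fun hAU => ?_
    have hAc : Aᶜ ∈ U := hU (ae_restrict_le (compl_mem_ae_iff.2 hA))
    exact hdisj A Aᶜ disjoint_compl_right hAU hAc
  · exact if_pos hΩU
  · exact fun δ hδ => if_pos (inter_mem (hUC δ hδ) hΩU)
  · exact if_neg (hdisj E (Ω \ E) disjoint_sdiff_right hEU)

theorem stmt0 {n : ℕ} (hn : 1 ≤ n) (Ω C : Set (Eucl n)) (hΩ : MeasurableSet Ω)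
    (hC : IsClosed C) (hCne : C.Nonempty) (hCcl : C ⊆ closure Ω)
    (hCnull : volume (C ∩ Ω) = 0) :
    ((∃ μ : Set (Eucl n) → ℝ, IsDensityMeasureAt Ω C μ) ↔
      ∀ δ : ℝ, 0 < δ → 0 < volume (thickening δ C ∩ Ω)) ∧
    (∀ E : Set (Eucl n), MeasurableSet E → E ⊆ Ω →
      (∀ δ : ℝ, 0 < δ → 0 < volume (thickening δ C ∩ E)) →
      ∃ μ : Set (Eucl n) → ℝ, IsDensityMeasureAt Ω C μ ∧ μ (Ω \ E) = 0) := by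
  refine ⟨⟨?_, fun h => ?_⟩, fun E hE hEΩ h => exists_isDensityMeasureAt_of_subset Ω C E hE hEΩ h⟩
  · rintro ⟨μ, -, -, hnull, -, hone⟩ δ hδ
    refine pos_iff_ne_zero.2 fun h0 => ?_
    have hzero := hnull _ (isOpen_thickening.measurableSet.inter hΩ) inter_subset_right h0
    rw [hone δ hδ] at hzero
    exact one_ne_zero hzero
  · obtain ⟨μ, hμ, -⟩ := exists_isDensityMeasureAt_of_subset Ω C Ω hΩ subset_rfl h
    exact ⟨μ, hμ⟩
end
end

section
/- Let Ω be a Borel subset of ℝⁿ, let C ⊆ closure(Ω) be a nonempty closed set with λ(C ∩ Ω) = 0, and let μ be a density measure at C on Ω. Then: (i) 0 ≤ μ(A) ≤ 1 for every Borel A ⊆ Ω; (ii) for every x ∈ ℝⁿ \ C there is an open set U containing x with μ(U ∩ Ω) = 0 (i.e., the core of μ meets ℝⁿ only inside C); (iii) μ is pure: every countably additive nonnegative Borel measure ν on Ω satisfying ν(A) ≤ μ(A) for all Borel A ⊆ Ω is the zero measure. -/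
open MeasureTheory Metric Set Filter Topology

noncomputable section

theorem IsDensityMeasureAt.mono {n : ℕ} {Ω C : Set (Eucl n)} {μ : Set (Eucl n) → ℝ}
    (hμ : IsDensityMeasureAt Ω C μ) {A B : Set (Eucl n)} (hA : MeasurableSet A)
    (hB : MeasurableSet B) (hBΩ : B ⊆ Ω) (hAB : A ⊆ B) : μ A ≤ μ B := by
  have h := hμ.1.2 A (B \ A) hA (hB.diff hA) (hAB.trans hBΩ) (sdiff_subset.trans hBΩ)
    disjoint_sdiff_right
  rw [union_sdiff_cancel hAB] at h
  linarith [hμ.2.1 (B \ A) (hB.diff hA) (sdiff_subset.trans hBΩ)]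

theorem IsDensityMeasureAt.eq_zero_of_disjoint_thickening {n : ℕ} {Ω C : Set (Eucl n)}
    {μ : Set (Eucl n) → ℝ} (hμ : IsDensityMeasureAt Ω C μ) (hΩ : MeasurableSet Ω)
    {A : Set (Eucl n)} (hA : MeasurableSet A) (hAΩ : A ⊆ Ω) {δ : ℝ} (hδ : 0 < δ)
    (hd : Disjoint A (thickening δ C)) : μ A = 0 := by
  have hT : MeasurableSet (thickening δ C ∩ Ω) := isOpen_thickening.measurableSet.inter hΩ
  have h := hμ.1.2 A (thickening δ C ∩ Ω) hA hT hAΩ inter_subset_right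
    (hd.mono_right inter_subset_left)
  have hle := hμ.mono (hA.union hT) hΩ subset_rfl (union_subset hAΩ inter_subset_right)
  linarith [hμ.2.1 A hA hAΩ, hμ.2.2.2.1, hμ.2.2.2.2 δ hδ]

theorem stmt1 {n : ℕ} (hn : 1 ≤ n) (Ω C : Set (Eucl n)) (hΩ : MeasurableSet Ω)
    (hC : IsClosed C) (hCne : C.Nonempty) (hCcl : C ⊆ closure Ω)
    (hCnull : volume (C ∩ Ω) = 0)
    (μ : Set (Eucl n) → ℝ) (hμ : IsDensityMeasureAt Ω C μ) :
    (∀ A : Set (Eucl n), MeasurableSet A → A ⊆ Ω → 0 ≤ μ A ∧ μ A ≤ 1) ∧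
    (∀ x : Eucl n, x ∉ C → ∃ U : Set (Eucl n), IsOpen U ∧ x ∈ U ∧ μ (U ∩ Ω) = 0) ∧
    (∀ ν : Measure (Eucl n),
      (∀ A : Set (Eucl n), MeasurableSet A → A ⊆ Ω → ν A ≤ ENNReal.ofReal (μ A)) →
      ν Ω = 0) := by
  refine ⟨fun A hA hAΩ => ⟨hμ.2.1 A hA hAΩ, hμ.2.2.2.1 ▸ hμ.mono hA hΩ subset_rfl hAΩ⟩, ?_, ?_⟩
  · intro x hx
    have hex : ∃ δ : ℝ, 0 < δ ∧ x ∉ cthickening δ C := by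
      rw [← hC.closure_eq, closure_eq_iInter_cthickening] at hx
      simpa using hx
    obtain ⟨δ, hδ, hxδ⟩ := hex
    have hU : IsOpen (cthickening δ C)ᶜ := isClosed_cthickening.isOpen_compl
    refine ⟨(cthickening δ C)ᶜ, hU, hxδ, hμ.eq_zero_of_disjoint_thickening hΩ
      (hU.measurableSet.inter hΩ) inter_subset_right hδ ?_⟩
    exact (disjoint_compl_left.mono_right (thickening_subset_cthickening δ C)).mono_left
      inter_subset_left
  · intro ν hν
    have hnull : ∀ A : Set (Eucl n), MeasurableSet A → A ⊆ Ω → μ A = 0 → ν A = 0 := by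
      intro A hA hAΩ h
      simpa [h] using hν A hA hAΩ
    have hCΩ : MeasurableSet (C ∩ Ω) := hC.measurableSet.inter hΩ
    have hcover : Ω ⊆ (C ∩ Ω) ∪ ⋃ k : ℕ, Ω \ thickening (1 / ((k : ℝ) + 1)) C := by
      intro x hx
      by_cases hxC : x ∈ C
      · exact Or.inl ⟨hxC, hx⟩
      · obtain ⟨k, hk⟩ := exists_nat_one_div_lt ((hC.notMem_iff_infDist_pos hCne).1 hxC)
        refine Or.inr (mem_iUnion.2 ⟨k, hx, fun h => ?_⟩)
        exact lt_asymm hk ((mem_thickening_iff_infDist_lt hCne).1 h)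
    refine measure_mono_null hcover (measure_union_null ?_ (measure_iUnion_null fun k => ?_))
    · exact hnull _ hCΩ inter_subset_right (hμ.2.2.1 _ hCΩ inter_subset_right hCnull)
    · have hm := hΩ.diff (isOpen_thickening (δ := 1 / ((k : ℝ) + 1)) (E := C)).measurableSet
      exact hnull _ hm sdiff_subset (hμ.eq_zero_of_disjoint_thickening hΩ hm sdiff_subset
        Nat.one_div_pos_of_nat disjoint_sdiff_left)
end
end

section
/- Let Ω be a Borel subset of ℝⁿ, let C ⊆ closure(Ω) be a nonempty closed set with λ(C ∩ Ω) = 0, and let E ⊆ Ω be a Borel set such that λ(E ∩ C_δ) > 0 for every δ > 0 and λ(E ∩ C_δ̃) < ∞ for some δ̃ > 0. Then there exists a finitely additive measure μ on Ω, vanishing on Lebesgue-null sets, such that for every Borel set A ⊆ Ω: liminf_{δ↓0} λ(A ∩ E ∩ C_δ)/λ(E ∩ C_δ) ≤ μ(A) ≤ limsup_{δ↓0} λ(A ∩ E ∩ C_δ)/λ(E ∩ C_δ). In particular μ is a density measure at C on Ω and μ(Ω \ E) = 0. -/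
open MeasureTheory Metric Set Filter Topology

noncomputable section

/-- A real function with values in `[0, 1]` has a limit along any ultrafilter finer than a
given filter, and this limit lies between the `liminf` and the `limsup` along that filter. -/
theorem exists_ultrafilter_tendsto_mem_Icc {α : Type*} {l : Filter α} {U : Ultrafilter α}
    (hU : (U : Filter α) ≤ l) {g : α → ℝ} (hg : ∀ x, g x ∈ Icc (0 : ℝ) 1) :
    ∃ x, Tendsto g U (𝓝 x) ∧ liminf g l ≤ x ∧ x ≤ limsup g l := by
  obtain ⟨x, -, hx⟩ := (isCompact_Icc (a := (0 : ℝ)) (b := 1)).ultrafilter_le_nhds (U.map g)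
    (le_principal_iff.2 (Filter.mem_map.2 (Filter.univ_mem' hg)))
  have hx : Tendsto g U (𝓝 x) := hx
  have hbelow : ∀ m : Filter α, IsBoundedUnder (· ≥ ·) m g := fun m =>
    isBoundedUnder_of ⟨0, fun y => (hg y).1⟩
  have habove : ∀ m : Filter α, IsBoundedUnder (· ≤ ·) m g := fun m =>
    isBoundedUnder_of ⟨1, fun y => (hg y).2⟩
  refine ⟨x, hx, ?_, ?_⟩
  · rw [← hx.liminf_eq]
    exact liminf_le_liminf_of_le hU (hbelow l) (habove U).isCoboundedUnder_ge
  · rw [← hx.limsup_eq]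
    exact limsup_le_limsup_of_le hU (hbelow U).isCoboundedUnder_le (habove l)

/-- The relative volume of `A` in `E` near `C`, as a function of the size of the neighborhood. -/
def relDensity {n : ℕ} (C E A : Set (Eucl n)) (δ : ℝ) : ℝ :=
  (volume (A ∩ E ∩ thickening δ C)).toReal / (volume (E ∩ thickening δ C)).toReal

theorem relDensity_mem_Icc {n : ℕ} (C E A : Set (Eucl n)) (δ : ℝ) :
    relDensity C E A δ ∈ Icc (0 : ℝ) 1 := by
  unfold relDensity
  refine ⟨by positivity, ?_⟩
  by_cases h : volume (E ∩ thickening δ C) = ⊤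
  · simp [h]
  · refine div_le_one_of_le₀ (ENNReal.toReal_mono h (measure_mono ?_)) ENNReal.toReal_nonneg
    exact inter_subset_inter_left _ inter_subset_right

theorem relDensity_eq_zero {n : ℕ} {C E A : Set (Eucl n)} (h : volume (A ∩ E) = 0) (δ : ℝ) :
    relDensity C E A δ = 0 := by
  simp [relDensity, measure_mono_null inter_subset_left h]

theorem relDensity_eq_one {n : ℕ} {C E A : Set (Eucl n)} {δ : ℝ}
    (hpos : 0 < volume (E ∩ thickening δ C)) (hfin : volume (E ∩ thickening δ C) < ⊤)
    (h : E ∩ thickening δ C ⊆ A) : relDensity C E A δ = 1 := by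
  have : A ∩ E ∩ thickening δ C = E ∩ thickening δ C := by
    rw [inter_assoc, inter_eq_right.2 h]
  rw [relDensity, this]
  exact div_self (ENNReal.toReal_pos hpos.ne' hfin.ne).ne'

theorem relDensity_union {n : ℕ} {C E A B : Set (Eucl n)} {δ : ℝ} (hE : MeasurableSet E)
    (hB : MeasurableSet B) (hAB : Disjoint A B) (hfin : volume (E ∩ thickening δ C) < ⊤) :
    relDensity C E (A ∪ B) δ = relDensity C E A δ + relDensity C E B δ := by
  have hlt : ∀ A : Set (Eucl n), volume (A ∩ E ∩ thickening δ C) ≠ ⊤ := fun A =>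
    ((measure_mono (inter_subset_inter_left _ inter_subset_right)).trans_lt hfin).ne
  have hd : Disjoint (A ∩ E ∩ thickening δ C) (B ∩ E ∩ thickening δ C) :=
    hAB.mono (inter_subset_left.trans inter_subset_left)
      (inter_subset_left.trans inter_subset_left)
  rw [relDensity, relDensity, relDensity, union_inter_distrib_right, union_inter_distrib_right,
    measure_union hd ((hB.inter hE).inter isOpen_thickening.measurableSet),
    ENNReal.toReal_add (hlt A) (hlt B), add_div]

theorem stmt2 {n : ℕ} (hn : 1 ≤ n) (Ω C : Set (Eucl n)) (hΩ : MeasurableSet Ω)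
    (hC : IsClosed C) (hCne : C.Nonempty) (hCcl : C ⊆ closure Ω)
    (hCnull : volume (C ∩ Ω) = 0)
    (E : Set (Eucl n)) (hE : MeasurableSet E) (hEΩ : E ⊆ Ω)
    (hpos : ∀ δ : ℝ, 0 < δ → 0 < volume (E ∩ thickening δ C))
    (hfin : ∃ δ : ℝ, 0 < δ ∧ volume (E ∩ thickening δ C) < ⊤) :
    ∃ μ : Set (Eucl n) → ℝ,
      IsFinAddOn Ω μ ∧
      (∀ A : Set (Eucl n), MeasurableSet A → A ⊆ Ω → volume A = 0 → μ A = 0) ∧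
      (∀ A : Set (Eucl n), MeasurableSet A → A ⊆ Ω →
        Filter.liminf (fun δ : ℝ =>
            (volume (A ∩ E ∩ thickening δ C)).toReal / (volume (E ∩ thickening δ C)).toReal)
          (𝓝[>] 0) ≤ μ A ∧
        μ A ≤ Filter.limsup (fun δ : ℝ =>
            (volume (A ∩ E ∩ thickening δ C)).toReal / (volume (E ∩ thickening δ C)).toReal)
          (𝓝[>] 0)) ∧
      IsDensityMeasureAt Ω C μ ∧ μ (Ω \ E) = 0 := by
  obtain ⟨δ₀, hδ₀, hfin⟩ := hfin
  have hlt : ∀ δ ≤ δ₀, volume (E ∩ thickening δ C) < ⊤ := fun δ h =>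
    (measure_mono (inter_subset_inter_right _ (thickening_mono h C))).trans_lt hfin
  have hU := Ultrafilter.of_le (𝓝[>] (0 : ℝ))
  set U := Ultrafilter.of (𝓝[>] (0 : ℝ))
  have hev : ∀ δ : ℝ, 0 < δ → ∀ᶠ t in (U : Filter ℝ), 0 < t ∧ t ≤ δ := fun δ hδ =>
    hU (Ioc_mem_nhdsGT hδ)
  choose μ hμ hinf hsup using fun A : Set (Eucl n) =>
    exists_ultrafilter_tendsto_mem_Icc hU (relDensity_mem_Icc C E A)
  have hzero : ∀ A : Set (Eucl n), volume (A ∩ E) = 0 → μ A = 0 := fun A hA =>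
    tendsto_nhds_unique (hμ A)
      (tendsto_const_nhds.congr fun δ => (relDensity_eq_zero hA δ).symm)
  have hnull : ∀ A : Set (Eucl n), MeasurableSet A → A ⊆ Ω → volume A = 0 → μ A = 0 :=
    fun A _ _ h => hzero A (measure_mono_null inter_subset_left h)
  have hone : ∀ (A : Set (Eucl n)) (δ : ℝ), 0 < δ → E ∩ thickening δ C ⊆ A → μ A = 1 := by
    intro A δ hδ h
    refine tendsto_nhds_unique (hμ A) (tendsto_const_nhds.congr' ?_)
    filter_upwards [hev δ hδ, hev δ₀ hδ₀] with t ht ht₀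
    exact (relDensity_eq_one (hpos t ht.1) (hlt t ht₀.2)
      ((inter_subset_inter_right _ (thickening_mono ht.2 C)).trans h)).symm
  have hadd : IsFinAddOn Ω μ := by
    refine ⟨hzero ∅ (by simp), fun A B _ hB _ _ hAB => ?_⟩
    refine tendsto_nhds_unique (hμ (A ∪ B)) (((hμ A).add (hμ B)).congr' ?_)
    filter_upwards [hev δ₀ hδ₀] with t ht
    exact (relDensity_union hE hB hAB (hlt t ht.2)).symm
  refine ⟨μ, hadd, hnull, fun A _ _ => ⟨hinf A, hsup A⟩, ⟨hadd, fun A _ _ => ?_, hnull,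
    hone Ω 1 one_pos (inter_subset_left.trans hEΩ), fun δ hδ => ?_⟩, hzero _ (by simp)⟩
  · exact ge_of_tendsto' (hμ A) fun δ => (relDensity_mem_Icc C E A δ).1
  · exact hone _ δ hδ (subset_inter inter_subset_right (inter_subset_left.trans hEΩ))
end
end

section
/- Let Ω be a Borel subset of ℝⁿ, let C ⊆ closure(Ω) be a nonempty closed set with λ(C ∩ Ω) = 0, and let E ⊆ Ω be a Borel set such that for all δ > 0 and all R > 0 one has λ(C_δ ∩ E ∩ {y : |y| > R}) > 0. Then there exists a finitely additive measure μ on Ω, nonnegative on Borel sets and vanishing on Lebesgue-null sets, with μ(Ω) = μ(E) = 1, μ(C_δ ∩ Ω) = 1 for all δ > 0, and μ(B) = 0 for every bounded Borel set B ⊆ Ω. -/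
open MeasureTheory Metric Set Filter Topology

noncomputable section

/-- The `0`-`1` valued set function of an ultrafilter. -/
def ultrafilterIndicator {α : Type*} (U : Ultrafilter α) (A : Set α) : ℝ :=
  open Classical in if A ∈ U then 1 else 0

lemma ultrafilterIndicator_of_mem {α : Type*} {U : Ultrafilter α} {A : Set α} (h : A ∈ U) :
    ultrafilterIndicator U A = 1 := if_pos h

lemma ultrafilterIndicator_of_compl_mem {α : Type*} {U : Ultrafilter α} {A : Set α}
    (h : Aᶜ ∈ U) : ultrafilterIndicator U A = 0 :=
  if_neg (Ultrafilter.compl_mem_iff_notMem.1 h)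

lemma ultrafilterIndicator_nonneg {α : Type*} (U : Ultrafilter α) (A : Set α) :
    0 ≤ ultrafilterIndicator U A := by
  unfold ultrafilterIndicator
  split_ifs <;> norm_num

lemma ultrafilterIndicator_union {α : Type*} (U : Ultrafilter α) {A B : Set α}
    (h : Disjoint A B) :
    ultrafilterIndicator U (A ∪ B) = ultrafilterIndicator U A + ultrafilterIndicator U B := by
  have hAB : ¬ (A ∈ U ∧ B ∈ U) := fun ⟨hA, hB⟩ =>
    U.neBot.ne (disjoint_self.1 (Filter.disjoint_of_disjoint_of_mem h hA hB))
  unfold ultrafilterIndicator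
  by_cases hA : A ∈ U <;> by_cases hB : B ∈ U <;> simp_all [Ultrafilter.union_mem_iff]

/-- If the sets of an antitone sequence all have positive measure, some ultrafilter contains every
one of them and every conull set. -/
lemma exists_ultrafilter_le_ae_of_antitone {α : Type*} [MeasurableSpace α] (ν : Measure α)
    {S : ℕ → Set α} (hS : Antitone S) (hpos : ∀ k, 0 < ν (S k)) :
    ∃ U : Ultrafilter α, (U : Filter α) ≤ ae ν ∧ ∀ k, S k ∈ U := by
  have hbasis := hasBasis_iInf_principal (directed_of_isDirected_le hS)
  have : NeBot (ae ν ⊓ ⨅ k, 𝓟 (S k)) := by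
    refine ((ae ν).basis_sets.inf_basis_neBot_iff hbasis).2 fun {s} hs {k} _ => ?_
    by_contra hne
    exact (hpos k).ne' (measure_mono_null (fun x hx hxs => hne ⟨x, hxs, hx⟩) hs)
  have hU := Ultrafilter.of_le (ae ν ⊓ ⨅ k, 𝓟 (S k))
  exact ⟨Ultrafilter.of (ae ν ⊓ ⨅ k, 𝓟 (S k)), hU.trans inf_le_left, fun k =>
    hU.trans inf_le_right (mem_iInf_of_mem k (mem_principal_self _))⟩

theorem stmt3 {n : ℕ} (hn : 1 ≤ n) (Ω C : Set (Eucl n)) (hΩ : MeasurableSet Ω)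
    (hC : IsClosed C) (hCne : C.Nonempty) (hCcl : C ⊆ closure Ω)
    (hCnull : volume (C ∩ Ω) = 0)
    (E : Set (Eucl n)) (hE : MeasurableSet E) (hEΩ : E ⊆ Ω)
    (hpos : ∀ δ : ℝ, 0 < δ → ∀ R : ℝ, 0 < R →
      0 < volume (thickening δ C ∩ E ∩ {y : Eucl n | R < ‖y‖})) :
    ∃ μ : Set (Eucl n) → ℝ,
      IsFinAddOn Ω μ ∧
      (∀ A : Set (Eucl n), MeasurableSet A → A ⊆ Ω → 0 ≤ μ A) ∧
      (∀ A : Set (Eucl n), MeasurableSet A → A ⊆ Ω → volume A = 0 → μ A = 0) ∧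
      μ Ω = 1 ∧ μ E = 1 ∧
      (∀ δ : ℝ, 0 < δ → μ (thickening δ C ∩ Ω) = 1) ∧
      (∀ B : Set (Eucl n), MeasurableSet B → B ⊆ Ω → Bornology.IsBounded B → μ B = 0) := by
  have hS : Antitone fun k : ℕ =>
      thickening (1 / ((k : ℝ) + 1)) C ∩ E ∩ {y : Eucl n | (k : ℝ) + 1 < ‖y‖} := by
    intro i j hij
    have hij' : (i : ℝ) ≤ j := by exact_mod_cast hij
    refine inter_subset_inter (inter_subset_inter_left _ (thickening_mono ?_ _))
      fun y (hy : (j : ℝ) + 1 < ‖y‖) => ?_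
    · exact one_div_le_one_div_of_le (by positivity) (by linarith)
    · exact lt_of_le_of_lt (by linarith) hy
  obtain ⟨U, hUae, hU⟩ := exists_ultrafilter_le_ae_of_antitone volume hS
    fun k => hpos _ (by positivity) _ (by positivity)
  have hUE : E ∈ U := mem_of_superset (hU 0) fun y hy => hy.1.2
  have hUΩ : Ω ∈ U := mem_of_superset hUE hEΩ
  refine ⟨ultrafilterIndicator U, ⟨?_, fun A B _ _ _ _ h => ultrafilterIndicator_union U h⟩,
    fun A _ _ => ultrafilterIndicator_nonneg U A, fun A _ _ hA => ?_,
    ultrafilterIndicator_of_mem hUΩ, ultrafilterIndicator_of_mem hUE, fun δ hδ => ?_,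
    fun B _ _ hB => ?_⟩
  · exact ultrafilterIndicator_of_compl_mem (compl_empty ▸ univ_mem)
  · exact ultrafilterIndicator_of_compl_mem (hUae (compl_mem_ae_iff.2 hA))
  · obtain ⟨k, hk⟩ := exists_nat_one_div_lt hδ
    exact ultrafilterIndicator_of_mem (inter_mem
      (mem_of_superset (hU k) fun y hy => thickening_mono hk.le _ hy.1.1) hUΩ)
  · obtain ⟨R, hR⟩ := hB.exists_norm_le
    obtain ⟨k, hk⟩ := exists_nat_ge R
    refine ultrafilterIndicator_of_compl_mem (mem_of_superset (hU k) fun y hy hyB => ?_)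
    have hy' : (k : ℝ) + 1 < ‖y‖ := hy.2
    linarith [hR y hyB]
end
end

section
/- Let Ω be a Borel subset of ℝⁿ (n ≥ 1) and let μ be a 0-1 measure on Ω. Then exactly one of the following holds: (a) there exists a unique x ∈ closure(Ω) with μ(B_δ(x) ∩ Ω) = 1 for all δ > 0; (b) μ(Ω \ closedBall(0,R)) = 1 for all R > 0. Moreover, there exists a unique unit vector v ∈ ℝⁿ such that μ(K(p, v, α) ∩ Ω) = 1 for every α ∈ (0, π/2), where p = x in case (a) and p = 0 in case (b), and K(p, v, α) := {y ∈ ℝⁿ : y ≠ p and the angle between y − p and v is less than α}. -/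
open MeasureTheory Metric Set Filter Topology

noncomputable section

/-- A 0-1 measure on `Ω`: a finitely additive measure vanishing on Lebesgue null sets,
taking only the values 0 and 1 on Borel subsets of `Ω`, with total mass 1. -/
def IsZeroOneMeasure {n : ℕ} (Ω : Set (Eucl n)) (μ : Set (Eucl n) → ℝ) : Prop :=
  IsFinAddOn Ω μ ∧
  (∀ A : Set (Eucl n), MeasurableSet A → A ⊆ Ω → volume A = 0 → μ A = 0) ∧
  (∀ A : Set (Eucl n), MeasurableSet A → A ⊆ Ω → μ A = 0 ∨ μ A = 1) ∧
  μ Ω = 1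

/-- The open cone with vertex , rotational axis  and half opening angle . -/
def ConeSet {n : ℕ} (p v : Eucl n) (α : ℝ) : Set (Eucl n) :=
  {y | y ≠ p ∧ InnerProductGeometry.angle (y - p) v < α}

open InnerProductGeometry in
theorem measurableSet_coneSet {n : ℕ} (p v : Eucl n) (α : ℝ) :
    MeasurableSet (ConeSet p v α) := by
  have hangle : Measurable fun y : Eucl n => angle (y - p) v := by
    unfold angle
    exact Real.continuous_arccos.measurable.comp (by fun_prop)
  exact (measurableSet_singleton p).compl.inter (measurableSet_lt hangle measurable_const)

namespace IsZeroOneMeasure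

variable {n : ℕ} {Ω : Set (Eucl n)} {μ : Set (Eucl n) → ℝ}

theorem add_diff (hΩ : MeasurableSet Ω) (hμ : IsZeroOneMeasure Ω μ) {A : Set (Eucl n)}
    (hA : MeasurableSet A) (hAΩ : A ⊆ Ω) : μ A + μ (Ω \ A) = 1 := by
  rw [← hμ.1.2 A (Ω \ A) hA (hΩ.diff hA) hAΩ sdiff_subset disjoint_sdiff_right,
    union_sdiff_cancel hAΩ, hμ.2.2.2]

theorem nonneg (hμ : IsZeroOneMeasure Ω μ) {A : Set (Eucl n)}
    (hA : MeasurableSet A) (hAΩ : A ⊆ Ω) : 0 ≤ μ A := by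
  rcases hμ.2.2.1 A hA hAΩ with h | h <;> norm_num [h]

theorem le_one (hμ : IsZeroOneMeasure Ω μ) {A : Set (Eucl n)}
    (hA : MeasurableSet A) (hAΩ : A ⊆ Ω) : μ A ≤ 1 := by
  rcases hμ.2.2.1 A hA hAΩ with h | h <;> norm_num [h]

theorem inter_eq_one (hμ : IsZeroOneMeasure Ω μ) {A B : Set (Eucl n)}
    (hA : MeasurableSet A) (hB : MeasurableSet B) (hAΩ : A ⊆ Ω) (hBΩ : B ⊆ Ω)
    (h1 : μ A = 1) (h2 : μ B = 1) : μ (A ∩ B) = 1 := by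
  have hAB : A ∩ B ⊆ Ω := inter_subset_left.trans hAΩ
  have hd : A \ B ⊆ Ω := sdiff_subset.trans hAΩ
  have e1 := hμ.1.2 (A ∩ B) (A \ B) (hA.inter hB) (hA.diff hB) hAB hd disjoint_inf_sdiff
  have e2 := hμ.1.2 B (A \ B) hB (hA.diff hB) hBΩ hd disjoint_sdiff_right
  rw [inter_union_sdiff] at e1
  have := hμ.le_one (hB.union (hA.diff hB)) (union_subset hBΩ hd)
  have := hμ.nonneg (hA.diff hB) hd
  linarith

/-- The Borel sets of full measure are exactly the Borel members of some ultrafilter. -/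
theorem exists_ultrafilter (hΩ : MeasurableSet Ω) (hμ : IsZeroOneMeasure Ω μ) :
    ∃ U : Ultrafilter (Eucl n), Ω ∈ U ∧
      ∀ A : Set (Eucl n), MeasurableSet A → A ⊆ Ω → (μ A = 1 ↔ A ∈ U) := by
  let B : FilterBasis (Eucl n) :=
    { sets := {A | MeasurableSet A ∧ A ⊆ Ω ∧ μ A = 1}
      nonempty := ⟨Ω, hΩ, Subset.rfl, hμ.2.2.2⟩
      inter_sets := by
        rintro A C ⟨hA, hAΩ, h1⟩ ⟨hC, hCΩ, h2⟩
        exact ⟨A ∩ C, ⟨hA.inter hC, inter_subset_left.trans hAΩ,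
          hμ.inter_eq_one hA hC hAΩ hCΩ h1 h2⟩, Subset.rfl⟩ }
  have : NeBot B.filter := by
    rw [neBot_iff, Ne, ← empty_mem_iff_bot, B.mem_filter_iff]
    rintro ⟨A, ⟨-, -, h1⟩, hA⟩
    rw [subset_empty_iff.1 hA, hμ.1.1] at h1
    exact zero_ne_one h1
  have mem {A : Set (Eucl n)} (hA : MeasurableSet A) (hAΩ : A ⊆ Ω) (h : μ A = 1) :
      A ∈ Ultrafilter.of B.filter :=
    Ultrafilter.of_le _ (B.mem_filter_of_mem ⟨hA, hAΩ, h⟩)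
  refine ⟨Ultrafilter.of B.filter, mem hΩ Subset.rfl hμ.2.2.2, fun A hA hAΩ => ⟨mem hA hAΩ, ?_⟩⟩
  intro hmem
  refine (hμ.2.2.1 A hA hAΩ).resolve_left fun h0 => ?_
  have h := hμ.add_diff hΩ hA hAΩ
  rw [h0, zero_add] at h
  have hinter := inter_mem hmem (mem (hΩ.diff hA) sdiff_subset h)
  rw [inter_sdiff_self] at hinter
  exact Ultrafilter.empty_notMem hinter

open InnerProductGeometry in
theorem existsUnique_direction (hn : 1 ≤ n) (hΩ : MeasurableSet Ω) (hμ : IsZeroOneMeasure Ω μ)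
    (p : Eucl n) :
    ∃! v : Eucl n, ‖v‖ = 1 ∧
      ∀ α : ℝ, 0 < α → α < Real.pi / 2 → μ (ConeSet p v α ∩ Ω) = 1 := by
  obtain ⟨U, hUΩ, hU⟩ := hμ.exists_ultrafilter hΩ
  have : Nonempty (Fin n) := ⟨⟨0, hn⟩⟩
  have : Nontrivial (Eucl n) := inferInstanceAs (Nontrivial (EuclideanSpace ℝ (Fin n)))
  have hpU : ∀ᶠ y in (U : Filter (Eucl n)), y ≠ p := by
    refine Ultrafilter.compl_mem_iff_notMem.2 fun hp => ?_
    have hmeas : MeasurableSet ({p} ∩ Ω) := (measurableSet_singleton p).inter hΩ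
    have h1 := (hU _ hmeas inter_subset_right).2 (inter_mem hp hUΩ)
    rw [hμ.2.1 _ hmeas inter_subset_right
      (measure_mono_null inter_subset_left (measure_singleton p))] at h1
    exact zero_ne_one h1
  have hcone (v : Eucl n) (α : ℝ) : μ (ConeSet p v α ∩ Ω) = 1 ↔
      ∀ᶠ y in (U : Filter (Eucl n)), angle (y - p) v < α := by
    rw [hU _ ((measurableSet_coneSet p v α).inter hΩ) inter_subset_right]
    refine ⟨fun h => mem_of_superset h fun y hy => hy.1.2, fun h => inter_mem ?_ hUΩ⟩
    exact hpU.and h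
  let g : Eucl n → Eucl n := fun y => ‖y - p‖⁻¹ • (y - p)
  obtain ⟨v, hv, hgv⟩ := (isCompact_sphere (0 : Eucl n) 1).ultrafilter_le_nhds (U.map g) (by
    rw [le_principal_iff]
    change ∀ᶠ y in (U : Filter (Eucl n)), g y ∈ sphere (0 : Eucl n) 1
    filter_upwards [hpU] with y hy
    rw [mem_sphere_zero_iff_norm, norm_smul, norm_inv, norm_norm,
      inv_mul_cancel₀ (norm_ne_zero_iff.2 (sub_ne_zero.2 hy))])
  rw [mem_sphere_zero_iff_norm] at hv
  have hne {w : Eucl n} (hw : ‖w‖ = 1) : w ≠ 0 := by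
    rintro rfl
    simp at hw
  have hlim {w : Eucl n} (hw : ‖w‖ = 1) :
      Tendsto (fun y => angle (y - p) w) (U : Filter (Eucl n)) (𝓝 (angle v w)) := by
    have hc : ContinuousAt (fun z : Eucl n => angle z w) v :=
      (continuousAt_angle (x := (v, w)) (hne hv) (hne hw)).comp
        (f := fun z : Eucl n => (z, w)) (by fun_prop)
    refine (hc.tendsto.comp (show Tendsto g U (𝓝 v) from hgv)).congr' ?_
    filter_upwards [hpU] with y hy
    exact angle_smul_left_of_pos _ _ (inv_pos.2 (norm_pos_iff.2 (sub_ne_zero.2 hy)))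
  refine ⟨v, ⟨hv, fun α hα _ => (hcone v α).2 ?_⟩, ?_⟩
  · refine (hlim hv).eventually_lt_const ?_
    rwa [angle_self (hne hv)]
  · rintro w ⟨hw, hwU⟩
    have hle : angle v w ≤ 0 := by
      by_contra! hpos
      have hα : 0 < min (angle v w) (Real.pi / 4) := lt_min hpos (by positivity)
      have hlt := (min_le_right (angle v w) (Real.pi / 4)).trans_lt
        (show Real.pi / 4 < Real.pi / 2 by linarith [Real.pi_pos])
      have hhalf := le_of_tendsto (hlim hw)
        (((hcone w _).1 (hwU _ (half_pos hα) (by linarith))).mono fun _ h => h.le)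
      linarith [min_le_left (angle v w) (Real.pi / 4)]
    have h0 := hle.antisymm (angle_nonneg v w)
    have hi := inner_eq_mul_norm_of_angle_eq_zero h0
    rw [hv, hw, one_mul] at hi
    exact ((inner_eq_one_iff_of_norm_eq_one hv hw).1 hi).symm

theorem xor_limit_point_escape (hΩ : MeasurableSet Ω) (hμ : IsZeroOneMeasure Ω μ) :
    Xor (∃! x : Eucl n, x ∈ closure Ω ∧ ∀ δ : ℝ, 0 < δ → μ (ball x δ ∩ Ω) = 1)
      (∀ R : ℝ, 0 < R → μ (Ω \ closedBall 0 R) = 1) := by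
  obtain ⟨U, hUΩ, hU⟩ := hμ.exists_ultrafilter hΩ
  have hball (x : Eucl n) : (∀ δ : ℝ, 0 < δ → μ (ball x δ ∩ Ω) = 1) ↔ (U : Filter _) ≤ 𝓝 x := by
    rw [nhds_basis_ball.ge_iff]
    refine forall₂_congr fun δ _ => ?_
    rw [hU _ (measurableSet_ball.inter hΩ) inter_subset_right]
    exact ⟨fun h => mem_of_superset h inter_subset_left, fun h => inter_mem h hUΩ⟩
  have hescape (R : ℝ) : μ (Ω \ closedBall 0 R) = 1 ↔ closedBall (0 : Eucl n) R ∉ U := by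
    rw [hU _ (hΩ.diff measurableSet_closedBall) sdiff_subset, ← Ultrafilter.compl_mem_iff_notMem]
    exact ⟨fun h => mem_of_superset h fun _ hy => hy.2, fun h => inter_mem hUΩ h⟩
  simp only [hball, hescape]
  by_cases h : ∀ R : ℝ, 0 < R → closedBall (0 : Eucl n) R ∉ U
  · refine Or.inr ⟨h, ?_⟩
    rintro ⟨x, ⟨-, hx⟩, -⟩
    refine h (‖x‖ + 1) (by positivity) (mem_of_superset (hx (ball_mem_nhds x one_pos)) ?_)
    refine ball_subset_closedBall.trans (closedBall_subset_closedBall' ?_)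
    rw [dist_zero_right, add_comm]
  · refine Or.inl ⟨?_, h⟩
    push Not at h
    obtain ⟨R, -, hR⟩ := h
    obtain ⟨x, -, hx⟩ := (isCompact_closedBall (0 : Eucl n) R).ultrafilter_le_nhds U
      (le_principal_iff.2 hR)
    refine ⟨x, ⟨mem_closure_iff_ultrafilter.2 ⟨U, hUΩ, hx⟩, hx⟩, ?_⟩
    rintro y ⟨-, hy⟩
    exact tendsto_nhds_unique (f := id) (l := (U : Filter (Eucl n))) hy hx

end IsZeroOneMeasure

theorem stmt8 {n : ℕ} (hn : 1 ≤ n) (Ω : Set (Eucl n)) (hΩ : MeasurableSet Ω)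
    (μ : Set (Eucl n) → ℝ) (hμ : IsZeroOneMeasure Ω μ) :
    Xor' (∃! x : Eucl n, x ∈ closure Ω ∧ ∀ δ : ℝ, 0 < δ → μ (ball x δ ∩ Ω) = 1)
      (∀ R : ℝ, 0 < R → μ (Ω \ closedBall 0 R) = 1) ∧
    (∀ x : Eucl n, x ∈ closure Ω → (∀ δ : ℝ, 0 < δ → μ (ball x δ ∩ Ω) = 1) →
      ∃! v : Eucl n, ‖v‖ = 1 ∧
        ∀ α : ℝ, 0 < α → α < Real.pi / 2 → μ (ConeSet x v α ∩ Ω) = 1) ∧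
    ((∀ R : ℝ, 0 < R → μ (Ω \ closedBall 0 R) = 1) →
      ∃! v : Eucl n, ‖v‖ = 1 ∧
        ∀ α : ℝ, 0 < α → α < Real.pi / 2 → μ (ConeSet 0 v α ∩ Ω) = 1) := by
  exact ⟨hμ.xor_limit_point_escape hΩ, fun x _ _ => hμ.existsUnique_direction hn hΩ x,
    fun _ => hμ.existsUnique_direction hn hΩ 0⟩
end
end

section
/- Let Ω be a Borel subset of ℝⁿ, let x ∈ Ω*, let f : Ω → ℝᵐ be locally integrable, and let γ ∈ ℝᵐ. Then γ is an essential value of f at x, i.e., λ({y ∈ Ω : |f(y) − γ| < ε} ∩ B_δ(x)) > 0 for all ε > 0 and δ > 0, if and only if there exists a 0-1 measure μ on Ω with μ(B_δ(x) ∩ Ω) = 1 for all δ > 0 and μ({y ∈ Ω : |f(y) − γ| < ε}) = 1 for all ε > 0. -/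
open MeasureTheory Metric Set Filter Topology

noncomputable section

/-- The set of points of positive lower Lebesgue density of `Ω`. -/
def OmegaStar {n : ℕ} (Ω : Set (Eucl n)) : Set (Eucl n) :=
  {x | x ∈ closure Ω ∧ ∀ δ : ℝ, 0 < δ → 0 < volume (Ω ∩ ball x δ)}

/-- A filter of sets of positive measure extends to an ultrafilter containing all conull sets. -/
lemma exists_ultrafilter_le_inf_ae {α : Type*} [MeasurableSpace α] {ν : Measure α}
    {F : Filter α} (hF : ∀ s ∈ F, 0 < ν s) : ∃ U : Ultrafilter α, ↑U ≤ F ⊓ ae ν := by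
  have : (F ⊓ ae ν).NeBot := by
    rw [inf_neBot_iff]
    intro s hs t ht
    by_contra h
    have hst : s ⊆ tᶜ := by
      rw [not_nonempty_iff_eq_empty, ← disjoint_iff_inter_eq_empty] at h
      exact h.subset_compl_right
    exact (hF s hs).ne' (measure_mono_null hst (mem_ae_iff.1 ht))
  exact Ultrafilter.exists_le _

open Classical in
/-- The indicator of an ultrafilter consisting of sets of positive measure is a 0-1 measure. -/
lemma isZeroOneMeasure_of_ultrafilter {n : ℕ} {Ω : Set (Eucl n)} (U : Ultrafilter (Eucl n))
    (hΩ : Ω ∈ U) (hU : ↑U ≤ ae (volume : Measure (Eucl n))) :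
    IsZeroOneMeasure Ω (fun A => if A ∈ U then 1 else 0) := by
  refine ⟨⟨if_neg U.empty_notMem, fun A B _ _ _ _ hAB => ?_⟩, fun A _ _ hA => ?_,
    fun A _ _ => ?_, if_pos hΩ⟩
  · have hAB' : ¬ (A ∈ U ∧ B ∈ U) := fun h =>
      U.empty_notMem (hAB.inter_eq ▸ inter_mem h.1 h.2)
    by_cases hA : A ∈ U <;> by_cases hB : B ∈ U <;>
      simp_all [Ultrafilter.union_mem_iff]
  · exact if_neg (Ultrafilter.compl_mem_iff_notMem.1 (hU (compl_mem_ae_iff.2 hA)))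
  · by_cases hA : A ∈ U <;> simp [hA]

/-- Sets of full mass for a 0-1 measure are closed under intersection. -/
lemma IsZeroOneMeasure.inter_eq_one_s11 {n : ℕ} {Ω A B : Set (Eucl n)} {μ : Set (Eucl n) → ℝ}
    (hμ : IsZeroOneMeasure Ω μ) (hAm : MeasurableSet A) (hBm : MeasurableSet B)
    (hAΩ : A ⊆ Ω) (hBΩ : B ⊆ Ω) (hA : μ A = 1) (hB : μ B = 1) : μ (A ∩ B) = 1 := by
  obtain ⟨⟨-, hadd⟩, -, h01, -⟩ := hμ
  have hdiff : A \ B ⊆ Ω := sdiff_subset.trans hAΩ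
  have h₁ := hadd (A ∩ B) (A \ B) (hAm.inter hBm) (hAm.diff hBm)
    (inter_subset_left.trans hAΩ) hdiff disjoint_inf_sdiff
  have h₂ := hadd B (A \ B) hBm (hAm.diff hBm) hBΩ hdiff disjoint_sdiff_right
  rw [inter_union_sdiff] at h₁
  rcases h01 _ (hBm.union (hAm.diff hBm)) (union_subset hBΩ hdiff) with h | h <;>
    rcases h01 _ (hAm.diff hBm) hdiff with h' | h' <;> linarith

theorem stmt11 {n m : ℕ} (hn : 1 ≤ n) (Ω : Set (Eucl n)) (hΩ : MeasurableSet Ω)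
    (x : Eucl n) (hx : x ∈ OmegaStar Ω)
    (f : Eucl n → Eucl m) (hfm : Measurable f)
    (hf : LocallyIntegrableOn f Ω volume) (γ : Eucl m) :
    (∀ ε : ℝ, 0 < ε → ∀ δ : ℝ, 0 < δ →
      0 < volume ({y ∈ Ω | ‖f y - γ‖ < ε} ∩ ball x δ)) ↔
    (∃ μ : Set (Eucl n) → ℝ, IsZeroOneMeasure Ω μ ∧
      (∀ δ : ℝ, 0 < δ → μ (ball x δ ∩ Ω) = 1) ∧
      (∀ ε : ℝ, 0 < ε → μ {y ∈ Ω | ‖f y - γ‖ < ε} = 1)) := by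
  constructor
  · intro h
    obtain ⟨U, hU⟩ := exists_ultrafilter_le_inf_ae (ν := (volume : Measure (Eucl n)))
      (F := (𝓟 Ω ⊓ comap f (𝓝 γ)) ⊓ 𝓝 x) (by
        have hb := (((nhds_basis_ball (x := γ)).comap f).principal_inf Ω).inf
          (nhds_basis_ball (x := x))
        intro s hs
        obtain ⟨⟨ε, δ⟩, ⟨hε, hδ⟩, hsub⟩ := hb.mem_iff.1 hs
        refine (h ε hε δ hδ).trans_le (measure_mono (Subset.trans ?_ hsub))
        rintro y ⟨⟨hyΩ, hy⟩, hyx⟩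
        exact ⟨⟨hyΩ, mem_ball_iff_norm.2 hy⟩, hyx⟩)
    obtain ⟨hUF, hUae⟩ := le_inf_iff.1 hU
    obtain ⟨hUΩf, hUx⟩ := le_inf_iff.1 hUF
    obtain ⟨hUΩ, hUf⟩ := le_inf_iff.1 hUΩf
    have hΩU : Ω ∈ U := le_principal_iff.1 hUΩ
    refine ⟨_, isZeroOneMeasure_of_ultrafilter U hΩU hUae, fun δ hδ => ?_, fun ε hε => ?_⟩
    · exact if_pos (inter_mem (hUx (ball_mem_nhds x hδ)) hΩU)
    · refine if_pos (inter_mem hΩU ?_)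
      filter_upwards [hUf (preimage_mem_comap (ball_mem_nhds γ hε))] with y hy
      exact mem_ball_iff_norm.1 hy
  · rintro ⟨μ, hμ, hball, hval⟩ ε hε δ hδ
    have hm : MeasurableSet {y ∈ Ω | ‖f y - γ‖ < ε} :=
      hΩ.inter (measurableSet_lt (hfm.sub_const γ).norm measurable_const)
    have hone := hμ.inter_eq_one_s11 hm (measurableSet_ball.inter hΩ) (sep_subset _ _)
      inter_subset_right (hval ε hε) (hball δ hδ)
    refine pos_iff_ne_zero.2 fun h0 => ?_
    have hnull := hμ.2.1 _ (hm.inter (measurableSet_ball.inter hΩ))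
      (inter_subset_left.trans (sep_subset _ _))
      (measure_mono_null (inter_subset_inter_right _ inter_subset_left) h0)
    exact one_ne_zero (hone.symm.trans hnull)
end
end

section
/- Let Ω be a Borel subset of ℝⁿ and let f : Ω → ℝᵐ be locally integrable. Suppose that for every x ∈ Ω* there exists g(x) ∈ ℝᵐ which is the essential limit of f at x. Then g : Ω* → ℝᵐ is continuous, and for every x ∈ Ω* the averages ⨍_{B_δ(x) ∩ Ω} f dλ converge to g(x) as δ ↓ 0. -/
open MeasureTheory Metric Set Filter Topology

noncomputable section

/-- The ratio `λ(B_δ(x) ∩ Ω ∩ S)/λ(B_δ(x) ∩ Ω)` tends to `0` as `δ ↓ 0`. -/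
def RatioTendstoZero {n : ℕ} (Ω : Set (Eucl n)) (x : Eucl n) (S : Set (Eucl n)) : Prop :=
  Tendsto (fun δ : ℝ =>
      (volume (ball x δ ∩ Ω ∩ S)).toReal / (volume (ball x δ ∩ Ω)).toReal)
    (𝓝[>] 0) (𝓝 0)

/-- Essential limits at points of `Ω*` depend continuously on the point. -/
theorem continuousOn_of_essLimit {n m : ℕ} {Ω : Set (Eucl n)} {f g : Eucl n → Eucl m}
    (hg : ∀ x ∈ OmegaStar Ω, ∀ ε : ℝ, 0 < ε → ∃ δ : ℝ, 0 < δ ∧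
      ∀ᵐ y ∂(volume.restrict (Ω ∩ ball x δ)), ‖f y - g x‖ ≤ ε) :
    ContinuousOn g (OmegaStar Ω) := by
  rw [Metric.continuousOn_iff]
  intro x hx ε hε
  obtain ⟨δ, hδ, hfx⟩ := hg x hx (ε / 3) (by positivity)
  refine ⟨δ, hδ, fun y hy hyx => ?_⟩
  obtain ⟨η, hη, hfy⟩ := hg y hy (ε / 3) (by positivity)
  have hr : 0 < min η (δ - dist y x) := lt_min hη (sub_pos.2 hyx)
  have hsub : ball y (min η (δ - dist y x)) ⊆ ball x δ :=
    (ball_subset_ball (min_le_right _ _)).trans (ball_subset_ball' (by linarith))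
  have hfx' := ae_restrict_of_ae_restrict_of_subset (inter_subset_inter_right Ω hsub) hfx
  have hfy' := ae_restrict_of_ae_restrict_of_subset
    (inter_subset_inter_right Ω (ball_subset_ball (min_le_left η (δ - dist y x)))) hfy
  have : (ae (volume.restrict (Ω ∩ ball y (min η (δ - dist y x))))).NeBot := by
    rw [ae_neBot, Ne, Measure.restrict_eq_zero]
    exact (hy.2 _ hr).ne'
  obtain ⟨z, hzx, hzy⟩ := (hfx'.and hfy').exists
  rw [← dist_eq_norm] at hzx hzy
  have := dist_triangle_left (g y) (g x) (f z)
  linarith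

/-- Averages over shrinking balls converge to the essential limit. -/
theorem tendsto_average_of_essLimit {n m : ℕ} {Ω : Set (Eucl n)} {f : Eucl n → Eucl m}
    (hf : AEStronglyMeasurable f (volume.restrict Ω)) {x : Eucl n} (hx : x ∈ OmegaStar Ω)
    {a : Eucl m}
    (ha : ∀ ε : ℝ, 0 < ε → ∃ δ : ℝ, 0 < δ ∧
      ∀ᵐ y ∂(volume.restrict (Ω ∩ ball x δ)), ‖f y - a‖ ≤ ε) :
    Tendsto (fun δ : ℝ => ⨍ y in ball x δ ∩ Ω, f y ∂volume) (𝓝[>] 0) (𝓝 a) := by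
  refine Metric.nhds_basis_closedBall.tendsto_right_iff.2 fun ε hε => ?_
  obtain ⟨δ, hδ, hfa⟩ := ha ε hε
  filter_upwards [Ioo_mem_nhdsGT hδ] with r hr
  rw [inter_comm]
  have hfr := ae_restrict_of_ae_restrict_of_subset
    (inter_subset_inter_right Ω (ball_subset_ball hr.2.le)) hfa
  have hfin : volume (Ω ∩ ball x r) < ⊤ :=
    (measure_mono inter_subset_right).trans_lt measure_ball_lt_top
  refine (convex_closedBall a ε).set_average_mem isClosed_closedBall
    (hx.2 r hr.1).ne' hfin.ne ?_ ?_
  · filter_upwards [hfr] with y hy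
    rwa [mem_closedBall, dist_eq_norm]
  · refine IntegrableOn.of_bound hfin
      (hf.mono_measure (Measure.restrict_mono inter_subset_left le_rfl)) (ε + ‖a‖) ?_
    filter_upwards [hfr] with y hy
    have := norm_sub_norm_le (f y) a
    linarith

theorem stmt13 {n m : ℕ} (hn : 1 ≤ n) (Ω : Set (Eucl n)) (hΩ : MeasurableSet Ω)
    (f : Eucl n → Eucl m) (hf : LocallyIntegrableOn f Ω volume)
    (g : Eucl n → Eucl m)
    (hg : ∀ x ∈ OmegaStar Ω, ∀ ε : ℝ, 0 < ε → ∃ δ : ℝ, 0 < δ ∧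
      ∀ᵐ y ∂(volume.restrict (Ω ∩ ball x δ)), ‖f y - g x‖ ≤ ε) :
    ContinuousOn g (OmegaStar Ω) ∧
    ∀ x ∈ OmegaStar Ω,
      Tendsto (fun δ : ℝ => ⨍ y in ball x δ ∩ Ω, f y ∂volume) (𝓝[>] 0) (𝓝 (g x)) := by
  exact ⟨continuousOn_of_essLimit hg, fun x hx =>
    tendsto_average_of_essLimit hf.aestronglyMeasurable hx (hg x hx)⟩
end
end

section
/- Let Ω be a Borel subset of ℝⁿ, let f : Ω → ℝᵐ be locally integrable, and let x ∈ closure(Ω). Assume there are an open convex set K ⊆ ℝⁿ which is a cone with vertex x (i.e., K is nonempty and x + t(y − x) ∈ K for all y ∈ K, t > 0) and r > 0 such that K ∩ B_r(x) ⊆ Ω. If (α₁, L₁) and (α₂, L₂) are both approximate differentials of f at x — that is, for i = 1,2 the function y ↦ |f(y) − α_i − L_i(y − x)|/|y − x| has approximate limit 0 at x — then α₁ = α₂ and L₁ = L₂. -/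
open MeasureTheory Metric Set Filter Topology

noncomputable section

/-- `h` has approximate limit `β` at `x` (with respect to `Ω`). -/
def HasApproxLimitAt {n : ℕ} (Ω : Set (Eucl n)) (h : Eucl n → ℝ) (x : Eucl n) (β : ℝ) :
    Prop :=
  ∀ ε : ℝ, 0 < ε →
    Tendsto (fun δ : ℝ =>
        (volume (ball x δ ∩ Ω ∩ {y | ε ≤ |h y - β|})).toReal /
          (volume (ball x δ ∩ Ω)).toReal)
      (𝓝[>] 0) (𝓝 0)

/-- `f` is approximately differentiable at `x` with data `(α, L)`. -/
def ApproxDiffAt {n : ℕ} {F : Type*} [NormedAddCommGroup F] [NormedSpace ℝ F]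
    (Ω : Set (Eucl n)) (f : Eucl n → F) (x : Eucl n) (α : F)
    (L : Eucl n →ₗ[ℝ] F) : Prop :=
  HasApproxLimitAt Ω (fun y => ‖f y - α - L (y - x)‖ / ‖y - x‖) x 0

theorem HasApproxLimitAt.eventually_measureReal_le {n : ℕ} {Ω : Set (Eucl n)} {h : Eucl n → ℝ}
    {x : Eucl n} {β : ℝ} (hh : HasApproxLimitAt Ω h x β) {ε θ : ℝ} (hε : 0 < ε) (hθ : 0 < θ) :
    ∀ᶠ δ in 𝓝[>] (0 : ℝ), volume.real (ball x δ ∩ Ω ∩ {y | ε ≤ |h y - β|}) ≤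
      θ * volume.real (ball x δ) := by
  filter_upwards [(hh ε hε).eventually_lt_const hθ] with δ hδ
  change volume.real _ / volume.real _ < θ at hδ
  have hfin : volume (ball x δ) ≠ ⊤ := measure_ball_lt_top.ne
  have hle : volume.real (ball x δ ∩ Ω) ≤ volume.real (ball x δ) :=
    measureReal_mono inter_subset_left hfin
  refine le_trans ?_ (mul_le_mul_of_nonneg_left hle hθ.le)
  rcases (measureReal_nonneg (μ := volume) (s := ball x δ ∩ Ω)).eq_or_lt with h0 | h0
  · rw [← h0, mul_zero, h0]
    exact measureReal_mono inter_subset_left (measure_ne_top_of_subset inter_subset_left hfin)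
  · exact ((div_lt_iff₀ h0).1 hδ).le

/-- Two functions with approximate limit `0` at the vertex of a cone in `Ω` are simultaneously
small somewhere in every small dilate of a ball contained in the cone. -/
theorem HasApproxLimitAt.eventually_exists_mem_ball {n : ℕ} (hn : 1 ≤ n) {Ω : Set (Eucl n)}
    {g h : Eucl n → ℝ} {x : Eucl n} (hg : HasApproxLimitAt Ω g x 0)
    (hh : HasApproxLimitAt Ω h x 0) {K : Set (Eucl n)}
    (hKcone : ∀ y ∈ K, ∀ t : ℝ, 0 < t → x + t • (y - x) ∈ K) {r : ℝ} (hr : 0 < r)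
    (hKΩ : K ∩ ball x r ⊆ Ω) {v : Eucl n} {ρ : ℝ} (hρ : 0 < ρ) (hv : ball (x + v) ρ ⊆ K)
    {ε : ℝ} (hε : 0 < ε) :
    ∀ᶠ t in 𝓝[>] (0 : ℝ), ∃ w ∈ ball v ρ, w ≠ 0 ∧ |g (x + t • w)| < ε ∧ |h (x + t • w)| < ε := by
  have : Nonempty (Fin n) := ⟨⟨0, hn⟩⟩
  have hR : 0 < ‖v‖ + ρ := by positivity
  set R := ‖v‖ + ρ
  have hθ : 0 < (ρ / R) ^ n / 3 := by positivity
  have htend : Tendsto (fun t : ℝ => t * R) (𝓝[>] 0) (𝓝[>] 0) := by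
    refine tendsto_nhdsWithin_iff.2 ⟨?_, ?_⟩
    · have : Tendsto (fun t : ℝ => t * R) (𝓝 0) (𝓝 (0 * R)) :=
        (continuous_id.mul continuous_const).tendsto 0
      rw [zero_mul] at this
      exact this.mono_left nhdsWithin_le_nhds
    · filter_upwards [self_mem_nhdsWithin] with t ht using mul_pos ht hR
  have hsmall : ∀ᶠ δ in 𝓝[>] (0 : ℝ), δ < r := nhdsWithin_le_nhds (eventually_lt_nhds hr)
  filter_upwards [htend.eventually (hg.eventually_measureReal_le hε hθ),
    htend.eventually (hh.eventually_measureReal_le hε hθ), htend.eventually hsmall,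
    self_mem_nhdsWithin] with t hgt hht htr ht
  have ht : 0 < t := ht
  by_contra! hcon
  set A := ball x (t * R) ∩ Ω ∩ {y | ε ≤ |g y - 0|}
  set B := ball x (t * R) ∩ Ω ∩ {y | ε ≤ |h y - 0|}
  have hsub : ball (x + t • v) (t * ρ) ⊆ (A ∪ B) ∪ {x} := by
    intro y hy
    obtain ⟨w, rfl⟩ : ∃ w, y = x + t • w := ⟨t⁻¹ • (y - x), by
      rw [smul_inv_smul₀ ht.ne']; abel⟩
    have hw : w ∈ ball v ρ := by
      rw [mem_ball, dist_add_left, dist_smul₀, Real.norm_of_nonneg ht.le] at hy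
      exact lt_of_mul_lt_mul_left hy ht.le
    have hwR : ‖w‖ < R := by
      have := norm_sub_norm_le w v
      rw [mem_ball, dist_eq_norm] at hw
      simp only [R]; linarith
    have hball : x + t • w ∈ ball x (t * R) := by
      rw [mem_ball, dist_eq_norm, add_sub_cancel_left, norm_smul, Real.norm_of_nonneg ht.le]
      exact mul_lt_mul_of_pos_left hwR ht
    have hK : x + t • w ∈ K := by
      have hxw : x + w ∈ K := hv (by rwa [mem_ball, dist_add_left])
      simpa using hKcone _ hxw t ht
    have hΩ' : x + t • w ∈ Ω := hKΩ ⟨hK, ball_subset_ball htr.le hball⟩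
    by_cases hw0 : w = 0
    · right; simp [hw0]
    left
    by_cases hgw : |g (x + t • w)| < ε
    · right
      exact ⟨⟨hball, hΩ'⟩, by simpa using hcon w hw hw0 hgw⟩
    · left
      exact ⟨⟨hball, hΩ'⟩, by simpa using hgw⟩
  have hfin : volume (ball x (t * R)) ≠ ⊤ := measure_ball_lt_top.ne
  have hA : volume A ≠ ⊤ :=
    measure_ne_top_of_subset (inter_subset_left.trans inter_subset_left) hfin
  have hB : volume B ≠ ⊤ :=
    measure_ne_top_of_subset (inter_subset_left.trans inter_subset_left) hfin
  have hle : volume.real (ball (x + t • v) (t * ρ)) ≤ volume.real A + volume.real B := by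
    calc _ ≤ volume.real ((A ∪ B) ∪ {x}) :=
          measureReal_mono hsub (measure_union_ne_top (measure_union_ne_top hA hB) (by simp))
      _ ≤ volume.real (A ∪ B) + volume.real {x} := measureReal_union_le _ _
      _ ≤ _ := by
        have : volume.real ({x} : Set (Eucl n)) = 0 := by simp [measureReal_def]
        rw [this, add_zero]
        exact measureReal_union_le _ _
  have hc : 0 < volume.real (ball (0 : Eucl n) 1) :=
    ENNReal.toReal_pos (measure_ball_pos _ _ one_pos).ne' measure_ball_lt_top.ne
  have hvol : ∀ (y : Eucl n) (s : ℝ), 0 < s →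
      volume.real (ball y s) = s ^ n * volume.real (ball (0 : Eucl n) 1) := fun y s hs => by
    rw [measureReal_def, Measure.addHaar_ball _ _ hs.le, finrank_euclideanSpace_fin,
      ENNReal.toReal_mul, ENNReal.toReal_ofReal (by positivity), measureReal_def]
  rw [hvol _ _ (mul_pos ht hR)] at hgt hht
  rw [hvol _ _ (mul_pos ht hρ)] at hle
  have hscale : (ρ / R) ^ n / 3 * ((t * R) ^ n * volume.real (ball (0 : Eucl n) 1)) =
      (t * ρ) ^ n * volume.real (ball (0 : Eucl n) 1) / 3 := by
    rw [div_pow, mul_pow, mul_pow]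
    field_simp
  have hpos : 0 < (t * ρ) ^ n * volume.real (ball (0 : Eucl n) 1) := by positivity
  linarith

/-- The affine difference of two approximate differentials at the vertex of a cone is small
somewhere in every small dilate of a ball contained in the cone. -/
theorem ApproxDiffAt.eventually_exists_norm_le {n : ℕ} (hn : 1 ≤ n) {F : Type*}
    [NormedAddCommGroup F] [NormedSpace ℝ F] {Ω : Set (Eucl n)} {f : Eucl n → F} {x : Eucl n}
    {α₁ α₂ : F} {L₁ L₂ : Eucl n →ₗ[ℝ] F} (h₁ : ApproxDiffAt Ω f x α₁ L₁)
    (h₂ : ApproxDiffAt Ω f x α₂ L₂) {K : Set (Eucl n)}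
    (hKcone : ∀ y ∈ K, ∀ t : ℝ, 0 < t → x + t • (y - x) ∈ K) {r : ℝ} (hr : 0 < r)
    (hKΩ : K ∩ ball x r ⊆ Ω) {v : Eucl n} {ρ : ℝ} (hρ : 0 < ρ) (hv : ball (x + v) ρ ⊆ K)
    {ε : ℝ} (hε : 0 < ε) :
    ∀ᶠ t in 𝓝[>] (0 : ℝ), ∃ w ∈ ball v ρ,
      ‖(α₁ - α₂) + t • (L₁ - L₂) w‖ ≤ t * (2 * ε * ‖w‖) := by
  filter_upwards [HasApproxLimitAt.eventually_exists_mem_ball hn h₁ h₂ hKcone hr hKΩ hρ hv hε,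
    self_mem_nhdsWithin] with t ⟨w, hw, hw0, hw₁, hw₂⟩ ht
  have ht : 0 < t := ht
  refine ⟨w, hw, ?_⟩
  have hpos : 0 < t * ‖w‖ := mul_pos ht (norm_pos_iff.2 hw0)
  simp only [add_sub_cancel_left, norm_smul, Real.norm_of_nonneg ht.le, abs_div, abs_norm,
    abs_of_pos hpos, div_lt_iff₀ hpos] at hw₁ hw₂
  have heq : (α₁ - α₂) + t • (L₁ - L₂) w =
      (f (x + t • w) - α₂ - L₂ (t • w)) - (f (x + t • w) - α₁ - L₁ (t • w)) := by
    rw [map_smul, map_smul, LinearMap.sub_apply, smul_sub]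
    abel
  rw [heq]
  have := norm_sub_le (f (x + t • w) - α₂ - L₂ (t • w)) (f (x + t • w) - α₁ - L₁ (t • w))
  linarith

theorem LinearMap.eq_zero_of_isOpen {E F : Type*} [NormedAddCommGroup E] [NormedSpace ℝ E]
    [AddCommGroup F] [Module ℝ F] (L : E →ₗ[ℝ] F) {U : Set E} (hU : IsOpen U)
    (hne : U.Nonempty) (h : ∀ v ∈ U, L v = 0) : L = 0 := by
  have htop : LinearMap.ker L = ⊤ :=
    Submodule.eq_top_of_nonempty_interior' _
      (hne.mono (interior_maximal h hU))
  exact LinearMap.ker_eq_top.1 htop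

theorem stmt14 {n m : ℕ} (hn : 1 ≤ n) (Ω : Set (Eucl n)) (hΩ : MeasurableSet Ω)
    (f : Eucl n → Eucl m) (hf : LocallyIntegrableOn f Ω volume)
    (x : Eucl n) (hx : x ∈ closure Ω)
    (K : Set (Eucl n)) (hKo : IsOpen K) (hKc : Convex ℝ K) (hKne : K.Nonempty)
    (hKcone : ∀ y ∈ K, ∀ t : ℝ, 0 < t → x + t • (y - x) ∈ K)
    (r : ℝ) (hr : 0 < r) (hKΩ : K ∩ ball x r ⊆ Ω)
    (α₁ α₂ : Eucl m) (L₁ L₂ : Eucl n →ₗ[ℝ] Eucl m)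
    (h₁ : ApproxDiffAt Ω f x α₁ L₁) (h₂ : ApproxDiffAt Ω f x α₂ L₂) :
    α₁ = α₂ ∧ L₁ = L₂ := by
  have key : ∀ v, x + v ∈ K → α₁ - α₂ = 0 ∧ (L₁ - L₂) v = 0 := by
    intro v hv
    obtain ⟨ρ₀, hρ₀, hball⟩ := Metric.isOpen_iff.1 hKo _ hv
    set a := α₁ - α₂
    set L := (L₁ - L₂).toContinuousLinearMap
    have hL : ∀ w, (L₁ - L₂) w = L w := fun _ => rfl
    have ha : a = 0 := by
      have hev := h₁.eventually_exists_norm_le hn h₂ hKcone hr hKΩ hρ₀ hball one_pos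
      have hlim : Tendsto (fun t : ℝ => t * ((2 + ‖L‖) * (‖v‖ + ρ₀))) (𝓝[>] 0) (𝓝 0) := by
        have : Tendsto (fun t : ℝ => t * ((2 + ‖L‖) * (‖v‖ + ρ₀))) (𝓝 0)
            (𝓝 (0 * ((2 + ‖L‖) * (‖v‖ + ρ₀)))) :=
          (continuous_id.mul continuous_const).tendsto 0
        rw [zero_mul] at this
        exact this.mono_left nhdsWithin_le_nhds
      refine norm_le_zero_iff.1 (ge_of_tendsto hlim ?_)
      filter_upwards [hev, self_mem_nhdsWithin] with t ⟨w, hw, hwt⟩ ht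
      have ht : 0 < t := ht
      rw [hL] at hwt
      have hwn : ‖w‖ ≤ ‖v‖ + ρ₀ := by
        have := norm_sub_norm_le w v
        rw [mem_ball, dist_eq_norm] at hw
        linarith
      calc ‖a‖ = ‖(a + t • L w) - t • L w‖ := by rw [add_sub_cancel_right]
        _ ≤ ‖a + t • L w‖ + ‖t • L w‖ := norm_sub_le _ _
        _ ≤ t * (2 * 1 * ‖w‖) + t * (‖L‖ * ‖w‖) := by
          rw [norm_smul, Real.norm_of_nonneg ht.le]
          gcongr
          exact L.le_opNorm w
        _ = t * ((2 + ‖L‖) * ‖w‖) := by ring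
        _ ≤ _ := by gcongr
    refine ⟨ha, ?_⟩
    have hbound : ∀ ε ∈ Ioo 0 ρ₀, ‖L v‖ ≤ 2 * ε * (‖v‖ + ε) + ‖L‖ * ε := by
      rintro ε ⟨hε, hερ⟩
      obtain ⟨t, ⟨w, hw, hwt⟩, ht⟩ :=
        ((h₁.eventually_exists_norm_le hn h₂ hKcone hr hKΩ hε
          ((ball_subset_ball hερ.le).trans hball) hε).and self_mem_nhdsWithin).exists
      have ht : 0 < t := ht
      change ‖a + _‖ ≤ _ at hwt
      rw [hL, ha, zero_add, norm_smul, Real.norm_of_nonneg ht.le] at hwt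
      have hLw := le_of_mul_le_mul_left hwt ht
      rw [mem_ball, dist_eq_norm] at hw
      have hwn : ‖w‖ ≤ ‖v‖ + ε := by
        have := norm_sub_norm_le w v
        linarith
      calc ‖L v‖ = ‖L w - L (w - v)‖ := by rw [map_sub, sub_sub_cancel]
        _ ≤ ‖L w‖ + ‖L (w - v)‖ := norm_sub_le _ _
        _ ≤ 2 * ε * ‖w‖ + ‖L‖ * ‖w - v‖ := add_le_add hLw (L.le_opNorm _)
        _ ≤ _ := by gcongr
    have hlim : Tendsto (fun ε : ℝ => 2 * ε * (‖v‖ + ε) + ‖L‖ * ε) (𝓝[>] 0) (𝓝 0) := by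
      have hcont : Continuous fun ε : ℝ => 2 * ε * (‖v‖ + ε) + ‖L‖ * ε := by fun_prop
      have := hcont.tendsto 0
      simp only [mul_zero, zero_mul, add_zero] at this
      exact this.mono_left nhdsWithin_le_nhds
    rw [hL]
    refine norm_le_zero_iff.1 (ge_of_tendsto hlim ?_)
    filter_upwards [Ioo_mem_nhdsGT hρ₀] with ε hε using hbound ε hε
  obtain ⟨p, hp⟩ := hKne
  have hp' : x + (p - x) ∈ K := by rwa [add_sub_cancel]
  refine ⟨sub_eq_zero.1 (key _ hp').1, sub_eq_zero.1 ?_⟩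
  exact LinearMap.eq_zero_of_isOpen _ (hKo.preimage (continuous_const.add continuous_id))
    ⟨p - x, hp'⟩ fun v hv => (key v hv).2
end
end

section
/- Let Ω ⊆ ℝⁿ be open, let F : ℝⁿ → ℝᵐ be locally Lipschitz on Ω (every point of Ω has a neighborhood on which F is Lipschitz), and let x, y ∈ Ω with x ≠ y and the closed segment [x, y] contained in Ω. Then the averages ⨍_{[x,y]_δ} (DF(z))(y − x) dλ(z), taken over the open δ-neighborhood [x,y]_δ of the segment, converge to F(y) − F(x) as δ ↓ 0, where DF(z) denotes the (Fréchet) derivative of F at z, which exists for λ-a.e. z ∈ Ω by Rademacher's theorem (the integral is unaffected by the null set where it fails to exist). -/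
open MeasureTheory Metric Set Filter Topology

noncomputable section

section Cylinder

variable {E G : Type*} [NormedAddCommGroup E] [NormedSpace ℝ E]
  [NormedAddCommGroup G] [NormedSpace ℝ G]

/-- The points `z` whose coordinate `ℓ (z - x)` lies in `[a, b)` and whose distance to the line
through `x` with direction `v`, measured along `ker ℓ`, is less than `r`. -/
def axialCylinder (ℓ : E →L[ℝ] ℝ) (v x : E) (r a b : ℝ) : Set E :=
  {z | ℓ (z - x) ∈ Ico a b ∧ ‖(z - x) - ℓ (z - x) • v‖ < r}

variable {ℓ : E →L[ℝ] ℝ} {v x : E} {r a b c : ℝ}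

theorem isBounded_cylinder : Bornology.IsBounded (axialCylinder ℓ v x r a b) := by
  refine (isBounded_iff_subset_closedBall x).2 ⟨r + max |a| |b| * ‖v‖, fun z hz => ?_⟩
  obtain ⟨⟨h₁, h₂⟩, h₃⟩ := hz
  have h₄ : |ℓ (z - x)| ≤ max |a| |b| := abs_le_max_abs_abs h₁ h₂.le
  have h₅ : ‖z - x‖ ≤ ‖(z - x) - ℓ (z - x) • v‖ + ‖ℓ (z - x) • v‖ := norm_le_norm_sub_add _ _
  rw [norm_smul, Real.norm_eq_abs] at h₅
  have := mul_le_mul_of_nonneg_right h₄ (norm_nonneg v)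
  rw [mem_closedBall, dist_eq_norm]
  linarith

theorem preimage_add_cylinder (hℓ : ℓ v = 1) (c : ℝ) :
    (fun z => z + c • v) ⁻¹' axialCylinder ℓ v x r (a + c) (b + c)
      = axialCylinder ℓ v x r a b := by
  ext z
  have h₁ : z + c • v - x = (z - x) + c • v := by abel
  have h₂ : ℓ ((z - x) + c • v) = ℓ (z - x) + c := by simp [hℓ]
  have h₃ : (z - x) + c • v - (ℓ (z - x) + c) • v = (z - x) - ℓ (z - x) • v := by
    rw [add_smul]; abel
  simp only [axialCylinder, mem_preimage, mem_ofPred_eq, h₁, h₂, h₃, mem_Ico, add_le_add_iff_right,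
    add_lt_add_iff_right]

theorem cylinder_union_cylinder (hab : a ≤ b) (hbc : b ≤ c) :
    axialCylinder ℓ v x r a b ∪ axialCylinder ℓ v x r b c = axialCylinder ℓ v x r a c := by
  have := Ico_union_Ico_eq_Ico hab hbc
  ext z
  simp only [axialCylinder, mem_union, mem_ofPred_eq, ← this]
  tauto

theorem disjoint_cylinder_cylinder :
    Disjoint (axialCylinder ℓ v x r a b) (axialCylinder ℓ v x r b c) :=
  Set.disjoint_left.2 fun _ h₁ h₂ => (h₁.1.2.trans_le h₂.1.1).false

theorem cylinder_subset_thickening_segment :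
    axialCylinder ℓ v x r 0 1 ⊆ thickening r (segment ℝ x (x + v)) := by
  intro z hz
  refine mem_thickening_iff.2 ⟨x + ℓ (z - x) • v, ?_, ?_⟩
  · rw [segment_eq_image']
    exact ⟨ℓ (z - x), ⟨hz.1.1, hz.1.2.le⟩, by simp⟩
  · rw [dist_eq_norm, ← sub_sub]
    exact hz.2

theorem thickening_segment_subset_cylinder (hℓ : ℓ v = 1)
    (hproj : ∀ u, ‖u - ℓ u • v‖ ≤ ‖u‖) {ε : ℝ} (hε : ‖ℓ‖ * r < ε) :
    thickening r (segment ℝ x (x + v)) ⊆ axialCylinder ℓ v x r (-ε) (1 + ε) := by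
  intro z hz
  obtain ⟨p, hp, hzp⟩ := mem_thickening_iff.1 hz
  rw [segment_eq_image'] at hp
  obtain ⟨s, ⟨hs₀, hs₁⟩, rfl⟩ := hp
  simp only [add_sub_cancel_left, dist_eq_norm] at hzp
  set u := z - (x + s • v) with hu
  have hzx : z - x = u + s • v := by rw [hu]; abel
  have hℓu : |ℓ u| < ε :=
    (ℓ.le_opNorm u).trans_lt ((mul_le_mul_of_nonneg_left hzp.le (norm_nonneg _)).trans_lt hε)
  obtain ⟨h₁, h₂⟩ := abs_lt.1 hℓu
  have hℓz : ℓ (z - x) = ℓ u + s := by simp [hzx, hℓ]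
  refine ⟨⟨by linarith, by linarith⟩, ?_⟩
  have : z - x - ℓ (z - x) • v = u - ℓ u • v := by rw [hℓz, hzx, add_smul]; abel
  rw [this]
  exact (hproj u).trans_lt hzp

variable [MeasurableSpace E] (μ : Measure E)

theorem measure_cylinder_ne_top [FiniteDimensional ℝ E] [μ.IsAddHaarMeasure] :
    μ (axialCylinder ℓ v x r a b) ≠ ⊤ :=
  isBounded_cylinder.measure_lt_top.ne

theorem measureReal_cylinder_pos [FiniteDimensional ℝ E] [μ.IsAddHaarMeasure] (hℓ : ℓ v = 1)
    (hr : 0 < r) :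
    0 < μ.real (axialCylinder ℓ v x r 0 1) := by
  refine ENNReal.toReal_pos (ne_of_gt ?_) (measure_cylinder_ne_top μ)
  have hc : Continuous fun z => ‖(z - x) - ℓ (z - x) • v‖ := by fun_prop
  have ho : IsOpen {z | ℓ (z - x) ∈ Ioo (0 : ℝ) 1 ∧ ‖(z - x) - ℓ (z - x) • v‖ < r} :=
    (isOpen_Ioo.preimage (by fun_prop : Continuous fun z => ℓ (z - x))).inter
      (isOpen_lt hc continuous_const)
  refine (ho.measure_pos μ ⟨x + (1 / 2 : ℝ) • v, ?_⟩).trans_le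
    (measure_mono fun z hz => ⟨Ioo_subset_Ico_self hz.1, hz.2⟩)
  simp only [mem_ofPred_eq, add_sub_cancel_left, map_smul, hℓ, smul_eq_mul, mul_one, sub_self,
    norm_zero, mem_Ioo]
  norm_num [hr]

variable [BorelSpace E]

theorem measurableSet_cylinder : MeasurableSet (axialCylinder ℓ v x r a b) := by
  have h : Continuous fun z => ℓ (z - x) := by fun_prop
  refine (measurableSet_Ico.preimage h.measurable).inter ?_
  have h' : Continuous fun z => ‖(z - x) - ℓ (z - x) • v‖ := by fun_prop
  exact (isOpen_lt h' continuous_const).measurableSet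

theorem LipschitzWith.integrableOn_fderiv_apply [FiniteDimensional ℝ G] [MeasurableSpace G]
    [BorelSpace G] {K : NNReal} {g : E → G} (hg : LipschitzWith K g) (v : E)
    {s : Set E} (hs : μ s ≠ ⊤) :
    IntegrableOn (fun z => fderiv ℝ g z v) s μ := by
  have : SecondCountableTopology G := secondCountable_of_proper
  have : CompleteSpace G := FiniteDimensional.complete ℝ G
  refine IntegrableOn.of_bound hs.lt_top
    (measurable_fderiv_apply_const ℝ g v).aestronglyMeasurable (K * ‖v‖) (ae_of_all _ fun z => ?_)
  exact ContinuousLinearMap.le_of_opNorm_le _ (norm_fderiv_le_of_lipschitz ℝ hg) v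

variable [μ.IsAddHaarMeasure]

theorem setIntegral_cylinder_comp_add (hℓ : ℓ v = 1) (g : E → G) (c : ℝ) :
    ∫ z in axialCylinder ℓ v x r a b, g (z + c • v) ∂μ
      = ∫ z in axialCylinder ℓ v x r (a + c) (b + c), g z ∂μ := by
  rw [← preimage_add_cylinder hℓ c]
  exact (measurePreserving_add_right μ (c • v)).setIntegral_preimage_emb
    (measurableEmbedding_addRight _) g _

theorem measureReal_cylinder_add (hℓ : ℓ v = 1) (c : ℝ) :
    μ.real (axialCylinder ℓ v x r (a + c) (b + c)) = μ.real (axialCylinder ℓ v x r a b) := by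
  rw [← preimage_add_cylinder (a := a) hℓ c, measureReal_def, measureReal_def,
    measure_preimage_add_right]

variable [FiniteDimensional ℝ E]

theorem measureReal_cylinder_natCast_mul (hℓ : ℓ v = 1) {h : ℝ} (hh : 0 ≤ h) (k : ℕ) :
    μ.real (axialCylinder ℓ v x r 0 (k * h)) = k * μ.real (axialCylinder ℓ v x r 0 h) := by
  induction k with
  | zero => simp [axialCylinder]
  | succ k ih =>
    have hk : 0 ≤ (k : ℝ) * h := by positivity
    have h₁ := measureReal_cylinder_add μ (x := x) (r := r) (a := 0) (b := h) hℓ (k * h)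
    rw [zero_add, add_comm h] at h₁
    have h₂ : ((k + 1 : ℕ) : ℝ) * h = k * h + h := by push_cast; ring
    rw [h₂, ← cylinder_union_cylinder hk (le_add_of_nonneg_right hh),
      measureReal_union disjoint_cylinder_cylinder measurableSet_cylinder
        (measure_cylinder_ne_top μ) (measure_cylinder_ne_top μ), ih, h₁]
    push_cast
    ring

theorem measureReal_cylinder_inv_natCast (hℓ : ℓ v = 1) {N : ℕ} (hN : N ≠ 0) :
    μ.real (axialCylinder ℓ v x r 0 (N : ℝ)⁻¹)
      = (N : ℝ)⁻¹ * μ.real (axialCylinder ℓ v x r 0 1) := by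
  have hN' : (N : ℝ) ≠ 0 := by exact_mod_cast hN
  have h := measureReal_cylinder_natCast_mul μ (x := x) (r := r) hℓ
    (h := (N : ℝ)⁻¹) (by positivity) N
  rw [mul_inv_cancel₀ hN'] at h
  rw [h, inv_mul_cancel_left₀ hN']

theorem Continuous.integrableOn_cylinder {H : Type*} [NormedAddCommGroup H] {g : E → H}
    (hg : Continuous g) :
    IntegrableOn g (axialCylinder ℓ v x r a b) μ :=
  (hg.locallyIntegrable.integrableOn_isCompact
    isBounded_cylinder.isCompact_closure).mono_set subset_closure

theorem setIntegral_cylinder_union {g : E → G} (hg : Continuous g) (hab : a ≤ b) (hbc : b ≤ c) :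
    ∫ z in axialCylinder ℓ v x r a c, g z ∂μ
      = ∫ z in axialCylinder ℓ v x r a b, g z ∂μ + ∫ z in axialCylinder ℓ v x r b c, g z ∂μ := by
  rw [← cylinder_union_cylinder hab hbc]
  exact setIntegral_union disjoint_cylinder_cylinder measurableSet_cylinder
    (hg.integrableOn_cylinder μ) (hg.integrableOn_cylinder μ)

/-- Integrating the increments of `g` in the direction `v` over a cylinder of length one reduces,
by translation invariance, to an integral over a slab at its base. -/
theorem setIntegral_cylinder_sub {g : E → G} (hg : Continuous g) (hℓ : ℓ v = 1) {h : ℝ}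
    (hh : 0 ≤ h) (hh' : h ≤ 1) :
    ∫ z in axialCylinder ℓ v x r 0 1, (g (z + h • v) - g z) ∂μ
      = ∫ z in axialCylinder ℓ v x r 0 h, (g (z + v) - g z) ∂μ := by
  have key (c : ℝ) : Continuous fun z => g (z + c • v) := by fun_prop
  have e₁ := setIntegral_cylinder_comp_add μ (x := x) (r := r) (a := 0) (b := 1) hℓ g h
  have e₂ := setIntegral_cylinder_comp_add μ (x := x) (r := r) (a := 0) (b := h) hℓ g 1
  simp only [one_smul, zero_add] at e₁ e₂
  have key₁ : Continuous fun z => g (z + v) := by fun_prop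
  rw [integral_sub ((key h).integrableOn_cylinder μ) (hg.integrableOn_cylinder μ),
    integral_sub (key₁.integrableOn_cylinder μ) (hg.integrableOn_cylinder μ), e₁, e₂,
    setIntegral_cylinder_union μ hg hh' (by linarith : (1 : ℝ) ≤ 1 + h),
    setIntegral_cylinder_union μ hg hh hh', add_comm h 1]
  abel

variable [FiniteDimensional ℝ G] {K : NNReal} {g : E → G}

theorem LipschitzWith.tendsto_setIntegral_sub (hg : LipschitzWith K g) (v : E) {s : Set E}
    (hs : μ s ≠ ⊤) :
    Tendsto (fun N : ℕ => ∫ z in s, (N : ℝ) • (g (z + (N : ℝ)⁻¹ • v) - g z) ∂μ) atTop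
      (𝓝 (∫ z in s, fderiv ℝ g z v ∂μ)) := by
  refine tendsto_integral_filter_of_dominated_convergence (fun _ => K * ‖v‖) ?_ ?_ ?_ ?_
  · refine Eventually.of_forall fun N => ?_
    have := hg.continuous
    exact Continuous.aestronglyMeasurable (by fun_prop)
  · filter_upwards [eventually_ne_atTop 0] with N hN
    refine ae_of_all _ fun z => ?_
    have hN' : (0 : ℝ) < N := by positivity
    have := hg.norm_sub_le (z + (N : ℝ)⁻¹ • v) z
    rw [add_sub_cancel_left, norm_smul, Real.norm_of_nonneg (by positivity)] at this
    rw [norm_smul, Real.norm_of_nonneg hN'.le]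
    calc (N : ℝ) * ‖g (z + (N : ℝ)⁻¹ • v) - g z‖ ≤ N * (K * ((N : ℝ)⁻¹ * ‖v‖)) := by gcongr
      _ = K * ‖v‖ := by field_simp
  · exact integrableOn_const hs
  · filter_upwards [ae_restrict_of_ae hg.ae_differentiableAt] with z hz
    refine hz.hasFDerivAt.lim v (c := fun N : ℕ => (N : ℝ)) (l := atTop) ?_ |>.congr fun N => ?_
    · exact tendsto_norm_atTop_atTop.comp tendsto_natCast_atTop_atTop
    · rfl

theorem LipschitzWith.norm_setIntegral_cylinder_sub_le (hg : LipschitzWith K g)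
    (hℓ : ℓ v = 1) :
    ‖∫ z in axialCylinder ℓ v x r 0 1, fderiv ℝ g z v ∂μ
        - μ.real (axialCylinder ℓ v x r 0 1) • (g (x + v) - g x)‖
      ≤ 2 * K * r * μ.real (axialCylinder ℓ v x r 0 1) := by
  set V := μ.real (axialCylinder ℓ v x r 0 1) with hV
  have hlim := ((hg.tendsto_setIntegral_sub μ v
    (measure_cylinder_ne_top μ (ℓ := ℓ) (v := v) (x := x) (r := r) (a := 0) (b := 1))).sub_const
    (V • (g (x + v) - g x))).norm
  have hbound : Tendsto (fun N : ℕ => 2 * K * (r + (N : ℝ)⁻¹ * ‖v‖) * V) atTop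
      (𝓝 (2 * K * (r + 0 * ‖v‖) * V)) :=
    (((tendsto_inv_atTop_nhds_zero_nat (𝕜 := ℝ)).mul_const _).const_add r |>.const_mul _).mul_const
      _
  rw [zero_mul, add_zero] at hbound
  refine le_of_tendsto_of_tendsto hlim hbound ?_
  filter_upwards [eventually_ne_atTop 0] with N hN
  have hN' : (0 : ℝ) < N := by positivity
  have hN₁ : (N : ℝ)⁻¹ ≤ 1 := Nat.cast_inv_le_one N
  have hc := hg.continuous
  have hS : μ.real (axialCylinder ℓ v x r 0 (N : ℝ)⁻¹) = (N : ℝ)⁻¹ * V :=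
    measureReal_cylinder_inv_natCast μ hℓ hN
  have hslab : (N : ℝ) • (∫ z in axialCylinder ℓ v x r 0 (N : ℝ)⁻¹,
      ((g (z + v) - g z) - (g (x + v) - g x)) ∂μ)
      = ∫ z in axialCylinder ℓ v x r 0 1, (N : ℝ) • (g (z + (N : ℝ)⁻¹ • v) - g z) ∂μ
        - V • (g (x + v) - g x) := by
    rw [integral_sub (Continuous.integrableOn_cylinder μ (by fun_prop))
      (Continuous.integrableOn_cylinder μ (by fun_prop)), integral_smul,
      setIntegral_cylinder_sub μ hc hℓ (by positivity) hN₁, setIntegral_const, hS, smul_sub,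
      smul_smul, mul_inv_cancel_left₀ hN'.ne']
  rw [← hslab, norm_smul, Real.norm_of_nonneg hN'.le]
  have hle : ‖∫ z in axialCylinder ℓ v x r 0 (N : ℝ)⁻¹,
      ((g (z + v) - g z) - (g (x + v) - g x)) ∂μ‖
      ≤ 2 * K * (r + (N : ℝ)⁻¹ * ‖v‖) * μ.real (axialCylinder ℓ v x r 0 (N : ℝ)⁻¹) := by
    refine norm_setIntegral_le_of_norm_le_const (measure_cylinder_ne_top μ).lt_top fun z hz => ?_
    have hz' : ‖z - x‖ ≤ r + (N : ℝ)⁻¹ * ‖v‖ := by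
      have h₅ : ‖z - x‖ ≤ ‖(z - x) - ℓ (z - x) • v‖ + ‖ℓ (z - x) • v‖ :=
        norm_le_norm_sub_add _ _
      rw [norm_smul, Real.norm_of_nonneg hz.1.1] at h₅
      have := mul_le_mul_of_nonneg_right hz.1.2.le (norm_nonneg v)
      linarith [hz.2]
    have h₁ := hg.norm_sub_le (z + v) (x + v)
    have h₂ := hg.norm_sub_le z x
    rw [add_sub_add_right_eq_sub] at h₁
    have h₃ : (g (z + v) - g z) - (g (x + v) - g x) = (g (z + v) - g (x + v)) - (g z - g x) := by
      abel
    rw [h₃]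
    have h₄ := _root_.norm_sub_le (g (z + v) - g (x + v)) (g z - g x)
    have h₅ := mul_le_mul_of_nonneg_left hz' K.coe_nonneg
    linarith
  rw [hS] at hle
  calc (N : ℝ) * _ ≤ N * (2 * K * (r + (N : ℝ)⁻¹ * ‖v‖) * ((N : ℝ)⁻¹ * V)) := by gcongr
    _ = 2 * K * (r + (N : ℝ)⁻¹ * ‖v‖) * V := by field_simp

theorem LipschitzWith.norm_setAverage_thickening_segment_sub_le (hg : LipschitzWith K g)
    (hℓ : ℓ v = 1) (hproj : ∀ u, ‖u - ℓ u • v‖ ≤ ‖u‖) (hr : 0 < r) {N : ℕ} (hN : N ≠ 0)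
    (hrN : ‖ℓ‖ * r < (N : ℝ)⁻¹) :
    ‖(⨍ z in thickening r (segment ℝ x (x + v)), fderiv ℝ g z v ∂μ) - (g (x + v) - g x)‖
      ≤ 2 * K * r + 4 * K * ‖v‖ * (N : ℝ)⁻¹ := by
  borelize G
  have : CompleteSpace G := FiniteDimensional.complete ℝ G
  set T := thickening r (segment ℝ x (x + v)) with hT
  set C := axialCylinder ℓ v x r 0 1 with hC
  set w := g (x + v) - g x with hw
  set ε := (N : ℝ)⁻¹ with hε
  have hε₀ : 0 ≤ ε := by positivity
  have hCT : C ⊆ T := cylinder_subset_thickening_segment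
  have hTC : T ⊆ axialCylinder ℓ v x r (-ε) (1 + ε) :=
    thickening_segment_subset_cylinder hℓ hproj hrN
  have hTtop : μ T ≠ ⊤ := ne_top_of_le_ne_top (measure_cylinder_ne_top μ) (measure_mono hTC)
  have hCpos : 0 < μ.real C := measureReal_cylinder_pos μ hℓ hr
  have hCle : μ.real C ≤ μ.real T := measureReal_mono hCT hTtop
  have hS : μ.real (axialCylinder ℓ v x r 0 ε) = ε * μ.real C :=
    measureReal_cylinder_inv_natCast μ hℓ hN
  have hdiff : μ.real (T \ C) ≤ 2 * ε * μ.real C := by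
    have hsub : T \ C ⊆ axialCylinder ℓ v x r (-ε) 0 ∪ axialCylinder ℓ v x r 1 (1 + ε) := by
      rintro z ⟨hzT, hzC⟩
      have h := hTC hzT
      rw [← cylinder_union_cylinder (b := 0) (by linarith) (by linarith),
        ← cylinder_union_cylinder (a := 0) (b := 1) (by linarith) (by linarith)] at h
      rcases h with h | h | h
      exacts [Or.inl h, absurd h hzC, Or.inr h]
    have e₁ := measureReal_cylinder_add μ (x := x) (r := r) (a := -ε) (b := 0) hℓ ε
    have e₂ := measureReal_cylinder_add μ (x := x) (r := r) (a := 0) (b := ε) hℓ 1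
    rw [neg_add_cancel, zero_add] at e₁
    rw [zero_add, add_comm ε] at e₂
    have h₁ := measureReal_mono (μ := μ) hsub
      (measure_union_ne_top (measure_cylinder_ne_top μ) (measure_cylinder_ne_top μ))
    have h₂ := measureReal_union_le (μ := μ) (axialCylinder ℓ v x r (-ε) 0)
      (axialCylinder ℓ v x r 1 (1 + ε))
    linarith
  have hw_le : ‖w‖ ≤ K * ‖v‖ := by simpa [hw] using hg.norm_sub_le (x + v) x
  have hDtop : μ (T \ C) ≠ ⊤ := ne_top_of_le_ne_top hTtop (measure_mono sdiff_subset)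
  have hrest : ‖∫ z in T \ C, (fderiv ℝ g z v - w) ∂μ‖ ≤ 2 * K * ‖v‖ * μ.real (T \ C) := by
    refine norm_setIntegral_le_of_norm_le_const hDtop.lt_top fun z _ => ?_
    have h₁ : ‖fderiv ℝ g z v‖ ≤ K * ‖v‖ :=
      ContinuousLinearMap.le_of_opNorm_le _ (norm_fderiv_le_of_lipschitz ℝ hg) v
    linarith [_root_.norm_sub_le (fderiv ℝ g z v) w]
  have hmain : ‖∫ z in C, (fderiv ℝ g z v - w) ∂μ‖ ≤ 2 * K * r * μ.real C := by
    rw [integral_sub (hg.integrableOn_fderiv_apply μ v (measure_cylinder_ne_top μ))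
      (integrableOn_const (measure_cylinder_ne_top μ)), setIntegral_const]
    exact hg.norm_setIntegral_cylinder_sub_le μ hℓ
  have hint : IntegrableOn (fun z => fderiv ℝ g z v - w) T μ :=
    (hg.integrableOn_fderiv_apply μ v hTtop).sub (integrableOn_const hTtop)
  have hsplit : ∫ z in T, (fderiv ℝ g z v - w) ∂μ
      = ∫ z in C, (fderiv ℝ g z v - w) ∂μ + ∫ z in T \ C, (fderiv ℝ g z v - w) ∂μ := by
    rw [← setIntegral_union disjoint_sdiff_right
      (isOpen_thickening.measurableSet.diff measurableSet_cylinder) (hint.mono_set hCT)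
      (hint.mono_set sdiff_subset), union_sdiff_cancel hCT]
  have hTpos : 0 < μ.real T := hCpos.trans_le hCle
  have havg : (⨍ z in T, fderiv ℝ g z v ∂μ) - w
      = (μ.real T)⁻¹ • ∫ z in T, (fderiv ℝ g z v - w) ∂μ := by
    rw [integral_sub (hg.integrableOn_fderiv_apply μ v hTtop) (integrableOn_const hTtop),
      setIntegral_const, smul_sub, smul_smul, inv_mul_cancel₀ hTpos.ne', one_smul, setAverage_eq]
  rw [havg, norm_smul, Real.norm_of_nonneg (by positivity), inv_mul_le_iff₀ hTpos, hsplit]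
  have hK : 0 ≤ 2 * (K : ℝ) * ‖v‖ := by positivity
  calc _ ≤ _ := norm_add_le _ _
    _ ≤ 2 * K * r * μ.real C + 2 * K * ‖v‖ * (2 * ε * μ.real C) :=
      add_le_add hmain (hrest.trans (mul_le_mul_of_nonneg_left hdiff hK))
    _ = μ.real C * (2 * K * r + 4 * K * ‖v‖ * ε) := by ring
    _ ≤ _ := by gcongr

theorem LipschitzWith.tendsto_setAverage_thickening_segment (hg : LipschitzWith K g)
    (hℓ : ℓ v = 1) (hproj : ∀ u, ‖u - ℓ u • v‖ ≤ ‖u‖) :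
    Tendsto (fun δ : ℝ => ⨍ z in thickening δ (segment ℝ x (x + v)), fderiv ℝ g z v ∂μ)
      (𝓝[>] 0) (𝓝 (g (x + v) - g x)) := by
  rw [tendsto_iff_norm_sub_tendsto_zero]
  refine tendsto_order.2 ⟨fun a ha => Eventually.of_forall fun _ => ha.trans_le (norm_nonneg _),
    fun η hη => ?_⟩
  have hNlim : Tendsto (fun N : ℕ => 4 * K * ‖v‖ * (N : ℝ)⁻¹) atTop (𝓝 (4 * K * ‖v‖ * 0)) :=
    (tendsto_inv_atTop_nhds_zero_nat (𝕜 := ℝ)).const_mul _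
  rw [mul_zero] at hNlim
  obtain ⟨N, hN, hNη⟩ :=
    ((eventually_ne_atTop 0).and (hNlim.eventually_lt_const (half_pos hη))).exists
  have hN' : (0 : ℝ) < (N : ℝ)⁻¹ := by positivity
  have h₁ : ∀ᶠ δ : ℝ in 𝓝[>] 0, ‖ℓ‖ * δ < (N : ℝ)⁻¹ :=
    nhdsWithin_le_nhds ((by fun_prop : Continuous fun δ : ℝ => ‖ℓ‖ * δ).tendsto 0
      |>.eventually_lt_const (by simpa using hN'))
  have h₂ : ∀ᶠ δ : ℝ in 𝓝[>] 0, 2 * K * δ < η / 2 :=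
    nhdsWithin_le_nhds ((by fun_prop : Continuous fun δ : ℝ => 2 * K * δ).tendsto 0
      |>.eventually_lt_const (by simpa using hη))
  filter_upwards [h₁, h₂, self_mem_nhdsWithin] with δ hδ₁ hδ₂ hδ
  have := hg.norm_setAverage_thickening_segment_sub_le μ (x := x) hℓ hproj hδ hN hδ₁
  linarith

end Cylinder

theorem exists_dual_norm_sub_smul_le {E : Type*} [NormedAddCommGroup E] [InnerProductSpace ℝ E]
    {v : E} (hv : v ≠ 0) : ∃ ℓ : E →L[ℝ] ℝ, ℓ v = 1 ∧ ∀ u, ‖u - ℓ u • v‖ ≤ ‖u‖ := by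
  have hv' : ‖v‖ ≠ 0 := norm_ne_zero_iff.2 hv
  refine ⟨(‖v‖ ^ 2)⁻¹ • innerSL ℝ v, ?_, fun u => ?_⟩
  · simp [hv']
  · rw [← sq_le_sq₀ (norm_nonneg _) (norm_nonneg _), norm_sub_sq_real, norm_smul, inner_smul_right,
      mul_pow, Real.norm_eq_abs, sq_abs, real_inner_comm]
    simp only [smul_apply, innerSL_apply_apply, smul_eq_mul]
    have : 0 ≤ (inner ℝ v u) ^ 2 * (‖v‖ ^ 2)⁻¹ := by positivity
    have h : ((‖v‖ ^ 2)⁻¹ * inner ℝ v u) ^ 2 * ‖v‖ ^ 2 = (inner ℝ v u) ^ 2 * (‖v‖ ^ 2)⁻¹ := by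
      field_simp
    linarith

theorem stmt16 {n m : ℕ} (hn : 1 ≤ n) (Ω : Set (Eucl n)) (hΩ : IsOpen Ω)
    (F : Eucl n → Eucl m)
    (hF : ∀ z ∈ Ω, ∃ U ∈ 𝓝 z, ∃ K : NNReal, LipschitzOnWith K F U)
    (x y : Eucl n) (hx : x ∈ Ω) (hy : y ∈ Ω) (hxy : x ≠ y)
    (hseg : segment ℝ x y ⊆ Ω) :
    Tendsto
      (fun δ : ℝ => ⨍ z in thickening δ (segment ℝ x y), (fderiv ℝ F z) (y - x) ∂volume)
      (𝓝[>] 0) (𝓝 (F y - F x)) := by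
  have hcompact : IsCompact (segment ℝ x y) := by
    rw [segment_eq_image']
    exact isCompact_Icc.image (by fun_prop)
  obtain ⟨δ₀, hδ₀, hsub⟩ := hcompact.exists_cthickening_subset_open hΩ hseg
  have hloc : LocallyLipschitzOn (cthickening δ₀ (segment ℝ x y)) F := fun z hz => by
    obtain ⟨U, hU, K, hK⟩ := hF z (hsub hz)
    exact ⟨K, U, mem_nhdsWithin_of_mem_nhds hU, hK⟩
  obtain ⟨K, hK⟩ := hloc.exists_lipschitzOnWith_of_compact hcompact.cthickening
  obtain ⟨g, hg, hFg⟩ := hK.extend_finite_dimension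
  obtain ⟨ℓ, hℓ, hproj⟩ := exists_dual_norm_sub_smul_le (sub_ne_zero.2 hxy.symm)
  have hlim := hg.tendsto_setAverage_thickening_segment volume (x := x) hℓ hproj
  have hmem : segment ℝ x y ⊆ cthickening δ₀ (segment ℝ x y) := self_subset_cthickening _
  rw [add_sub_cancel, ← hFg (hmem (left_mem_segment ℝ x y)),
    ← hFg (hmem (right_mem_segment ℝ x y))] at hlim
  refine hlim.congr' ?_
  filter_upwards [Ioo_mem_nhdsGT hδ₀] with δ hδ
  rw [setAverage_eq, setAverage_eq]
  congr 1
  refine setIntegral_congr_fun isOpen_thickening.measurableSet fun z hz => ?_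
  have heq : F =ᶠ[𝓝 z] g :=
    mem_of_superset (isOpen_thickening.mem_nhds hz) fun p hp =>
      hFg (thickening_subset_cthickening_of_le hδ.2.le _ hp)
  simp only [heq.fderiv_eq]
end
end

section
/- Let Ω ⊆ ℝⁿ be open, let F : ℝⁿ → ℝᵐ be locally Lipschitz on Ω, and let x ∈ Ω. For a Lebesgue-null set N ⊆ Ω let D_x^N F := {M : there is a sequence x_j → x with F differentiable at each x_j, x_j ∉ N, and DF(x_j) → M}. Then for every Lebesgue-null set N ⊆ Ω, the convex hull of D_x^N F equals the convex hull of D_x^∅ F; i.e., Clarke's generalized Jacobian conv{lim_j DF(x_j) : x_j → x, x_j differentiability points of F outside N} does not depend on the null set N. -/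
open MeasureTheory Metric Set Filter Topology

noncomputable section

/-- The set of limits of derivatives of `F` along sequences of differentiability points
in `Ω \ N` converging to `x`. -/
def DerivLimitSet {n m : ℕ} (Ω : Set (Eucl n)) (F : Eucl n → Eucl m) (x : Eucl n)
    (N : Set (Eucl n)) : Set (Eucl n →L[ℝ] Eucl m) :=
  {M | ∃ u : ℕ → Eucl n,
    (∀ j, u j ∈ Ω ∧ u j ∉ N ∧ DifferentiableAt ℝ F (u j)) ∧
    Tendsto u atTop (𝓝 x) ∧
    Tendsto (fun j => fderiv ℝ F (u j)) atTop (𝓝 M)}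

section ConvexHull

variable {V : Type*} [NormedAddCommGroup V] [NormedSpace ℝ V]

theorem isCompact_convexJoin {s t : Set V} (hs : IsCompact s) (ht : IsCompact t) :
    IsCompact (convexJoin ℝ s t) := by
  have h : convexJoin ℝ s t =
      (fun p : ℝ × V × V => (1 - p.1) • p.2.1 + p.1 • p.2.2) '' (Icc (0 : ℝ) 1 ×ˢ s ×ˢ t) := by
    ext z
    simp only [mem_convexJoin, segment_eq_image, mem_image, mem_prod, Prod.exists]
    constructor
    · rintro ⟨a, ha, b, hb, θ, hθ, rfl⟩
      exact ⟨θ, a, b, ⟨hθ, ha, hb⟩, rfl⟩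
    · rintro ⟨θ, a, b, ⟨hθ, ha, hb⟩, rfl⟩
      exact ⟨a, ha, b, hb, θ, hθ, rfl⟩
  rw [h]
  exact (isCompact_Icc.prod (hs.prod ht)).image (by fun_prop)

/-- The set of convex combinations of at most `k + 1` points of `s`. -/
def iteratedConvexJoin (s : Set V) : ℕ → Set V
  | 0 => s
  | k + 1 => convexJoin ℝ s (iteratedConvexJoin s k)

theorem isCompact_iteratedConvexJoin {s : Set V} (hs : IsCompact s) (k : ℕ) :
    IsCompact (iteratedConvexJoin s k) := by
  induction k with
  | zero => exact hs
  | succ k ih => exact isCompact_convexJoin hs ih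

theorem iteratedConvexJoin_subset_convexHull (s : Set V) (k : ℕ) :
    iteratedConvexJoin s k ⊆ convexHull ℝ s := by
  induction k with
  | zero => exact subset_convexHull ℝ s
  | succ k ih =>
    exact convexJoin_subset (subset_convexHull ℝ s) ih (convex_convexHull ℝ s)

theorem convexHull_finset_subset_iteratedConvexJoin {s : Set V} (k : ℕ) {t : Finset V}
    (ht : (t : Set V) ⊆ s) (hk : t.card = k + 1) :
    convexHull ℝ (t : Set V) ⊆ iteratedConvexJoin s k := by
  classical
  induction k generalizing t with
  | zero =>
    obtain ⟨a, rfl⟩ := Finset.card_eq_one.1 hk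
    simpa [iteratedConvexJoin] using ht
  | succ k ih =>
    obtain ⟨a, r, -, rfl, hr⟩ := Finset.card_eq_succ.1 hk
    rw [Finset.coe_insert] at ht ⊢
    have hne : (r : Set V).Nonempty := by
      rw [Finset.coe_nonempty, ← Finset.card_pos]
      lia
    rw [convexHull_insert hne]
    exact convexJoin_mono (singleton_subset_iff.2 (ht (mem_insert _ _)))
      (ih ((subset_insert _ _).trans ht) hr)

theorem IsCompact.convexHull_of_finiteDimensional [FiniteDimensional ℝ V] {s : Set V}
    (hs : IsCompact s) : IsCompact (convexHull ℝ s) := by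
  have h : convexHull ℝ s =
      ⋃ k ∈ Finset.range (Module.finrank ℝ V + 1), iteratedConvexJoin s k := by
    apply Subset.antisymm
    · rw [convexHull_eq_union]
      simp only [iUnion_subset_iff]
      intro t hts hind z hz
      have hcard : t.card ≤ Module.finrank ℝ V + 1 := by
        simpa using hind.card_le_finrank_succ.trans
          (Nat.succ_le_succ (Submodule.finrank_le _))
      have hpos : 0 < t.card := by
        rw [Finset.card_pos, ← Finset.coe_nonempty]
        exact convexHull_nonempty_iff.1 ⟨z, hz⟩
      refine mem_biUnion (x := t.card - 1) ?_
        (convexHull_finset_subset_iteratedConvexJoin _ hts (by lia) hz)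
      simp only [Finset.coe_range, mem_Iio]
      lia
    · exact iUnion₂_subset fun k _ => iteratedConvexJoin_subset_convexHull s k
  rw [h]
  exact (Finset.range _).isCompact_biUnion fun k _ => isCompact_iteratedConvexJoin hs k

end ConvexHull

section SequentialLimits

variable {E V : Type*} [NormedAddCommGroup E] [NormedAddCommGroup V]

/-- The set of limits of `T` along sequences in `G` converging to `x`. -/
def seqLimitSet (T : E → V) (G : Set E) (x : E) : Set V :=
  {M | ∃ u : ℕ → E, (∀ j, u j ∈ G) ∧ Tendsto u atTop (𝓝 x) ∧
    Tendsto (fun j => T (u j)) atTop (𝓝 M)}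

theorem isClosed_seqLimitSet (T : E → V) (G : Set E) (x : E) :
    IsClosed (seqLimitSet T G x) := by
  have h : seqLimitSet T G x =
      (fun M => (x, M)) ⁻¹' closure ((fun y => (y, T y)) '' G) := by
    ext M
    simp only [seqLimitSet, mem_ofPred_eq, mem_preimage, mem_closure_iff_seq_limit]
    constructor
    · rintro ⟨u, hu, hux, huM⟩
      exact ⟨fun j => (u j, T (u j)), fun j => mem_image_of_mem _ (hu j),
        hux.prodMk_nhds huM⟩
    · rintro ⟨w, hw, hlim⟩
      choose u hu huw using hw
      obtain rfl : (fun j => (u j, T (u j))) = w := funext huw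
      exact ⟨u, hu, (continuous_fst.tendsto _).comp hlim, (continuous_snd.tendsto _).comp hlim⟩
  rw [h]
  exact isClosed_closure.preimage (by fun_prop)

variable [NormedSpace ℝ V] [FiniteDimensional ℝ V]

/-- A point in the closed convex hull of the values of `T` near `x`, at every scale, is a
convex combination of limits of values of `T`. -/
theorem mem_convexHull_seqLimitSet {T : E → V} {G : Set E} {x : E} {K δ : ℝ} (hδ : 0 < δ)
    (hT : ∀ y ∈ G ∩ ball x δ, ‖T y‖ ≤ K) {M : V}
    (hM : ∀ ε, 0 < ε → M ∈ closure (convexHull ℝ (T '' (G ∩ ball x ε)))) :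
    M ∈ convexHull ℝ (seqLimitSet T G x) := by
  have hcomp : IsCompact (seqLimitSet T G x) := by
    refine (isCompact_closedBall (0 : V) K).of_isClosed_subset (isClosed_seqLimitSet T G x) ?_
    rintro A ⟨u, hu, hux, huA⟩
    refine isClosed_closedBall.mem_of_tendsto huA ?_
    filter_upwards [hux (ball_mem_nhds x hδ)] with j hj
    simpa using hT _ ⟨hu j, hj⟩
  by_contra hcon
  obtain ⟨f, c, hfc, hcM⟩ := geometric_hahn_banach_closed_point (convex_convexHull ℝ _)
    hcomp.convexHull_of_finiteDimensional.isClosed hcon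
  have hex : ∀ ε, 0 < ε → ∃ y ∈ G ∩ ball x ε, c < f (T y) := by
    intro ε hε
    by_contra! hle
    have hsub : closure (convexHull ℝ (T '' (G ∩ ball x ε))) ⊆ {A | f A ≤ c} :=
      closure_minimal
        (convexHull_min (image_subset_iff.2 hle) (convex_halfSpace_le f.isLinear c))
        (isClosed_le f.continuous continuous_const)
    exact (hsub (hM ε hε)).not_gt hcM
  have hpos : ∀ k : ℕ, 0 < δ / (k + 1) := fun k => by positivity
  choose u hu hfu using fun k : ℕ => hex _ (hpos k)
  have hux : Tendsto u atTop (𝓝 x) := by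
    rw [tendsto_iff_dist_tendsto_zero]
    refine squeeze_zero (fun _ => dist_nonneg) (fun k => (mem_ball.1 (hu k).2).le) ?_
    simpa [div_eq_mul_inv] using tendsto_one_div_add_atTop_nhds_zero_nat.const_mul δ
  obtain ⟨A, -, φ, hφ, hA⟩ := (isCompact_closedBall (0 : V) K).tendsto_subseq
    (x := fun k => T (u k)) fun k => by
      simpa using hT _ ⟨(hu k).1, ball_subset_ball
        (div_le_self hδ.le (by simp)) (hu k).2⟩
  have hAmem : A ∈ seqLimitSet T G x :=
    ⟨u ∘ φ, fun j => (hu _).1, hux.comp hφ.tendsto_atTop, hA⟩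
  have hcA : c ≤ f A :=
    ge_of_tendsto ((f.continuous.tendsto A).comp hA) (Eventually.of_forall fun j => (hfu _).le)
  exact hcA.not_gt (hfc A (subset_convexHull ℝ _ hAmem))

end SequentialLimits

section BlowUp

variable {E F : Type*} [NormedAddCommGroup E] [NormedSpace ℝ E] [NormedAddCommGroup F]
  [NormedSpace ℝ F] {f : E → F} {K : NNReal}

/-- The difference quotient of `f` at `z` at scale `r`. -/
def blowUp (f : E → F) (z : E) (r : ℝ) (y : E) : F := r⁻¹ • (f (z + r • y) - f z)

theorem lipschitzWith_blowUp (hf : LipschitzWith K f) (z : E) {r : ℝ} (hr : r ≠ 0) :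
    LipschitzWith K (blowUp f z r) := by
  refine LipschitzWith.of_dist_le_mul fun y w => ?_
  have h := hf.norm_sub_le (z + r • y) (z + r • w)
  rw [add_sub_add_left_eq_sub, ← smul_sub, norm_smul] at h
  rw [dist_eq_norm, dist_eq_norm, blowUp, blowUp, ← smul_sub,
    sub_sub_sub_cancel_right, norm_smul, norm_inv, inv_mul_le_iff₀ (norm_pos_iff.2 hr)]
  linarith

theorem fderiv_blowUp (f : E → F) (z : E) {r : ℝ} (hr : r ≠ 0) (y : E) :
    fderiv ℝ (blowUp f z r) y = fderiv ℝ f (z + r • y) := by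
  have h : fderiv ℝ (fun y => f (z + r • y)) y = r • fderiv ℝ f (z + r • y) := by
    rw [fderiv_comp_smul (f := fun w => f (z + w)), fderiv_comp_add_left]
  change fderiv ℝ (r⁻¹ • fun y => f (z + r • y) - f z) y = _
  rw [fderiv_const_smul_field, Pi.smul_apply, fderiv_sub_const, h, smul_smul,
    inv_mul_cancel₀ hr, one_smul]

theorem tendsto_blowUp {z : E} (hz : DifferentiableAt ℝ f z) (y : E) :
    Tendsto (fun r => blowUp f z r y) (𝓝[≠] 0) (𝓝 (fderiv ℝ f z y)) :=
  (hz.hasFDerivAt.hasLineDerivAt y).tendsto_slope_zero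

end BlowUp

section Averages

variable {E F : Type*} [NormedAddCommGroup E] [NormedSpace ℝ E] [FiniteDimensional ℝ E]
  [MeasurableSpace E] [BorelSpace E] [NormedAddCommGroup F] [NormedSpace ℝ F]
  [FiniteDimensional ℝ F] {f : E → F} {K : NNReal} (μ : Measure E)

theorem integrable_smul_fderiv_of_lipschitz (hf : LipschitzWith K f) {g : E → ℝ}
    (hg : Integrable g μ) :
    Integrable (fun y => g y • fderiv ℝ f y) μ := by
  borelize (E →L[ℝ] F)
  exact hg.smul_bdd K (measurable_fderiv ℝ f).aestronglyMeasurable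
    (Eventually.of_forall fun y => norm_fderiv_le_of_lipschitz ℝ hf)

variable [μ.IsAddHaarMeasure]

theorem LipschitzWith.integral_smul_fderiv_apply (hf : LipschitzWith K f) {g : E → ℝ}
    (hg : ContDiff ℝ 1 g) (hc : HasCompactSupport g) (v : E) :
    ∫ y, g y • fderiv ℝ f y v ∂μ = -∫ y, fderiv ℝ g y v • f y ∂μ := by
  have hint : Integrable (fun y => g y • fderiv ℝ f y v) μ := by
    simpa using (integrable_smul_fderiv_of_lipschitz μ hf
      (hg.continuous.integrable_of_hasCompactSupport hc)).apply_continuousLinearMap v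
  have hint' : Integrable (fun y => fderiv ℝ g y v • f y) μ := by
    refine Continuous.integrable_of_hasCompactSupport
      (((hg.continuous_fderiv one_ne_zero).clm_apply continuous_const).smul hf.continuous) ?_
    exact (hc.fderiv_apply ℝ v).smul_right
  refine (SeparatingDual.eq_iff_forall_dual_eq (R := ℝ)).2 fun l => ?_
  obtain ⟨D, hD⟩ := hg.lipschitzWith_of_hasCompactSupport hc one_ne_zero
  have key := integral_lineDeriv_mul_eq (μ := μ) (l.lipschitz.comp hf) hD hc v
  rw [← l.integral_comp_comm hint, map_neg, ← l.integral_comp_comm hint', ← integral_neg]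
  convert key using 1
  · refine integral_congr_ae ?_
    filter_upwards [hf.ae_differentiableAt (μ := μ)] with y hy
    have h := (l.hasFDerivAt.comp y hy.hasFDerivAt).hasLineDerivAt v
    rw [h.lineDeriv]
    simp [mul_comm]
  · refine integral_congr_ae (Eventually.of_forall fun y => ?_)
    simp [((hg.differentiable one_ne_zero) y).lineDeriv_eq_fderiv]

/-- Weighted averages of the derivative of a Lipschitz function around a point of
differentiability converge to the derivative at that point. -/
theorem LipschitzWith.continuousAt_integral_smul_fderiv (hf : LipschitzWith K f) {z : E}
    (hz : DifferentiableAt ℝ f z) {g : E → ℝ} (hg : ContDiff ℝ 1 g) (hc : HasCompactSupport g)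
    (hg1 : ∫ y, g y ∂μ = 1) :
    ContinuousAt (fun r : ℝ => ∫ y, g y • fderiv ℝ f (z + r • y) ∂μ) 0 := by
  have hgint := hg.continuous.integrable_of_hasCompactSupport (μ := μ) hc
  rw [continuousAt_clm_apply]
  intro v
  rw [continuousAt_iff_punctured_nhds]
  have h0 : (∫ y, g y • fderiv ℝ f (z + (0 : ℝ) • y) ∂μ) v =
      -∫ y, fderiv ℝ g y v • fderiv ℝ f z y ∂μ := by
    rw [← (fderiv ℝ f z).lipschitz.integral_smul_fderiv_apply μ hg hc]
    simp [integral_smul_const, hg1]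
  rw [h0]
  have hr : (fun r : ℝ => -∫ y, fderiv ℝ g y v • blowUp f z r y ∂μ) =ᶠ[𝓝[≠] 0]
      fun r => (∫ y, g y • fderiv ℝ f (z + r • y) ∂μ) v := by
    filter_upwards [self_mem_nhdsWithin] with r (hr : r ≠ 0)
    have hint := integrable_smul_fderiv_of_lipschitz μ (lipschitzWith_blowUp hf z hr) hgint
    simp_rw [← fderiv_blowUp f z hr]
    rw [← (lipschitzWith_blowUp hf z hr).integral_smul_fderiv_apply μ hg hc,
      ContinuousLinearMap.integral_apply hint]
    rfl
  refine Tendsto.congr' hr (Tendsto.neg ?_)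
  have hg' : Continuous fun y => fderiv ℝ g y v :=
    (hg.continuous_fderiv one_ne_zero).clm_apply continuous_const
  refine tendsto_integral_filter_of_dominated_convergence
    (fun y => ‖fderiv ℝ g y v‖ * (K * ‖y‖)) ?_ ?_ ?_ ?_
  · filter_upwards [self_mem_nhdsWithin] with r (hr : r ≠ 0)
    exact (hg'.smul (lipschitzWith_blowUp hf z hr).continuous).aestronglyMeasurable
  · filter_upwards [self_mem_nhdsWithin] with r (hr : r ≠ 0)
    refine Eventually.of_forall fun y => ?_
    rw [norm_smul]
    gcongr
    simpa [blowUp] using (lipschitzWith_blowUp hf z hr).norm_sub_le y 0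
  · exact Continuous.integrable_of_hasCompactSupport (by fun_prop)
      (hc.fderiv_apply ℝ v).norm.mul_right
  · exact Eventually.of_forall fun y => (tendsto_blowUp hz y).const_smul _

theorem ae_add_smul_mem {G : Set E} (hG : ∀ᵐ y ∂μ, y ∈ G) (z : E) {r : ℝ} (hr : r ≠ 0) :
    ∀ᵐ y ∂μ, z + r • y ∈ G := by
  have h : μ ((fun y => r • y) ⁻¹' ((fun y => z + y) ⁻¹' Gᶜ)) = 0 := by
    rw [Measure.addHaar_preimage_smul μ hr, measure_preimage_add, show μ Gᶜ = 0 from hG, mul_zero]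
  exact h

/-- The derivative of a Lipschitz function at a point lies in the closed convex hull of
its derivatives at nearby points of a set of full measure. -/
theorem LipschitzWith.fderiv_mem_closure_convexHull (hf : LipschitzWith K f) {z : E}
    (hz : DifferentiableAt ℝ f z) {G : Set E} (hG : ∀ᵐ y ∂μ, y ∈ G) {ε : ℝ} (hε : 0 < ε) :
    fderiv ℝ f z ∈ closure (convexHull ℝ (fderiv ℝ f '' (G ∩ ball z ε))) := by
  let b : ContDiffBump (0 : E) := ⟨1 / 2, 1, by norm_num, by norm_num⟩
  set g : E → ℝ := b.normed μ with hgdef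
  have hg : ContDiff ℝ 1 g := b.contDiff_normed
  have hg1 : ∫ y, g y ∂μ = 1 := b.integral_normed
  have hcont := hf.continuousAt_integral_smul_fderiv μ hz hg b.hasCompactSupport_normed hg1
  have hlim := hcont.tendsto.mono_left (nhdsWithin_le_nhds (s := Ioi (0 : ℝ)))
  simp only [zero_smul, add_zero, integral_smul_const, hg1, one_smul] at hlim
  refine isClosed_closure.mem_of_tendsto hlim ?_
  filter_upwards [Ioc_mem_nhdsGT hε] with r hr
  have hr0 : r ≠ 0 := hr.1.ne'
  have hmeas : Measurable fun y => ENNReal.ofReal (g y) :=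
    hg.continuous.measurable.ennreal_ofReal
  have hprob : IsProbabilityMeasure (μ.withDensity fun y => ENNReal.ofReal (g y)) := by
    refine ⟨?_⟩
    rw [withDensity_apply _ MeasurableSet.univ, Measure.restrict_univ,
      ← ofReal_integral_eq_lintegral_ofReal b.integrable_normed
        (Eventually.of_forall b.nonneg_normed), hg1, ENNReal.ofReal_one]
  have heq : ∫ y, g y • fderiv ℝ f (z + r • y) ∂μ =
      ∫ y, fderiv ℝ f (z + r • y) ∂(μ.withDensity fun y => ENNReal.ofReal (g y)) := by
    rw [integral_withDensity_eq_integral_toReal_smul hmeas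
      (Eventually.of_forall fun _ => ENNReal.ofReal_lt_top)]
    exact integral_congr_ae (Eventually.of_forall fun y => by
      simp only [ENNReal.toReal_ofReal (show 0 ≤ g y from b.nonneg_normed y)])
  rw [heq]
  refine (convex_convexHull ℝ _).closure.integral_mem isClosed_closure ?_ ?_
  · rw [ae_withDensity_iff hmeas]
    filter_upwards [ae_add_smul_mem μ hG z hr0] with y hy hgy
    refine subset_closure (subset_convexHull ℝ _ (mem_image_of_mem _ ⟨hy, ?_⟩))
    have hy1 : y ∈ ball (0 : E) 1 := by
      have : y ∈ Function.support (b.normed μ) := fun h => hgy (by simp [hgdef, h])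
      rwa [b.support_normed_eq] at this
    rw [mem_ball_zero_iff] at hy1
    rw [mem_ball, dist_eq_norm, add_sub_cancel_left, norm_smul, Real.norm_of_nonneg hr.1.le]
    nlinarith [hr.1, hr.2, norm_nonneg y]
  · borelize (E →L[ℝ] F)
    refine Integrable.of_bound (C := K) ?_ (Eventually.of_forall fun y =>
      norm_fderiv_le_of_lipschitz ℝ hf)
    exact ((measurable_fderiv ℝ f).comp (by fun_prop)).aestronglyMeasurable

end Averages

theorem derivLimitSet_empty_subset_convexHull {n m : ℕ} {Ω : Set (Eucl n)} (hΩ : IsOpen Ω)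
    {F : Eucl n → Eucl m} {x : Eucl n} (hx : x ∈ Ω) {U : Set (Eucl n)} (hU : U ∈ 𝓝 x)
    {K : NNReal} (hF : LipschitzOnWith K F U) {N : Set (Eucl n)} (hN : volume N = 0) :
    DerivLimitSet Ω F x ∅ ⊆ convexHull ℝ (DerivLimitSet Ω F x N) := by
  obtain ⟨δ, hδ, hball⟩ := Metric.mem_nhds_iff.1 (inter_mem hU (hΩ.mem_nhds hx))
  obtain ⟨f, hf, hFf⟩ := hF.extend_finite_dimension
  have hgerm : ∀ y ∈ ball x δ, F =ᶠ[𝓝 y] f := fun y hy => by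
    filter_upwards [isOpen_ball.mem_nhds hy] with w hw using hFf (hball hw).1
  set G : Set (Eucl n) := {y | y ∈ Ω ∧ y ∉ N ∧ DifferentiableAt ℝ F y}
  rintro M ⟨u, hu, hux, huM⟩
  refine mem_convexHull_seqLimitSet (T := fderiv ℝ F) (G := G) hδ
    (fun y hy => norm_fderiv_le_of_lipschitzOn ℝ
      (mem_of_superset (isOpen_ball.mem_nhds hy.2) fun w hw => (hball hw).1) hF)
    fun ε hε => isClosed_closure.mem_of_tendsto huM ?_
  have hae : ∀ᵐ y, y ∈ {y | y ∉ N ∧ DifferentiableAt ℝ f y} :=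
    (measure_eq_zero_iff_ae_notMem.1 hN).and hf.ae_differentiableAt
  have hρ : 0 < min δ ε / 2 := by positivity
  filter_upwards [hux (ball_mem_nhds x hρ)] with j hj
  have hsub : ball (u j) (min δ ε / 2) ⊆ ball x (min δ ε) :=
    ball_subset_ball' (by linarith [mem_ball.1 hj])
  have huδ : u j ∈ ball x δ := ball_subset_ball (min_le_left _ _) (hsub (mem_ball_self hρ))
  rw [(hgerm _ huδ).fderiv_eq]
  refine closure_mono (convexHull_mono ?_) (hf.fderiv_mem_closure_convexHull volume
    ((hgerm _ huδ).differentiableAt_iff.1 (hu j).2.2) hae hρ)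
  rintro _ ⟨y, ⟨⟨hyN, hyf⟩, hy⟩, rfl⟩
  have hyδ : y ∈ ball x δ := ball_subset_ball (min_le_left _ _) (hsub hy)
  exact ⟨y, ⟨⟨(hball hyδ).2, hyN, (hgerm _ hyδ).differentiableAt_iff.2 hyf⟩,
    ball_subset_ball (min_le_right _ _) (hsub hy)⟩, (hgerm _ hyδ).fderiv_eq⟩

theorem stmt18 {n m : ℕ} (hn : 1 ≤ n) (Ω : Set (Eucl n)) (hΩ : IsOpen Ω)
    (F : Eucl n → Eucl m)
    (hF : ∀ z ∈ Ω, ∃ U ∈ 𝓝 z, ∃ K : NNReal, LipschitzOnWith K F U)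
    (x : Eucl n) (hx : x ∈ Ω) :
    ∀ N : Set (Eucl n), N ⊆ Ω → volume N = 0 →
      convexHull ℝ (DerivLimitSet Ω F x N) = convexHull ℝ (DerivLimitSet Ω F x ∅) := by
  intro N _ hN
  obtain ⟨U, hU, K, hK⟩ := hF x hx
  refine Subset.antisymm (convexHull_mono ?_) (convexHull_min
    (derivLimitSet_empty_subset_convexHull hΩ hx hU hK hN) (convex_convexHull ℝ _))
  rintro M ⟨u, hu, hux, huM⟩
  exact ⟨u, fun j => ⟨(hu j).1, notMem_empty _, (hu j).2.2⟩, hux, huM⟩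
end
end

section
/- Let Ω ⊆ ℝⁿ be open, let x ∈ Ω, let F : ℝⁿ → ℝᵐ be Lipschitz on a neighborhood of x, and let L : ℝⁿ → ℝᵐ be a linear map such that DF(y) → L as y → x along the set of points where F is differentiable. Then F is strictly differentiable at x with strict derivative L, i.e., for every v ∈ ℝⁿ one has (F(y + tv) − F(y))/t → Lv as y → x and t ↓ 0. -/
open MeasureTheory Metric Set Filter Topology

noncomputable section

/-- A Lipschitz curve on `[a, b]` whose derivative has norm at most `C` almost everywhere moves by
at most `C * (b - a)`. -/
theorem norm_sub_le_of_ae_hasDerivAt_norm_le {F : Type*} [NormedAddCommGroup F] [NormedSpace ℝ F]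
    {g : ℝ → F} {a b C : ℝ} {K : NNReal} (hab : a ≤ b) (hg : LipschitzOnWith K g (Icc a b))
    (hg' : ∀ᵐ s, s ∈ Icc a b → ∃ g', HasDerivAt g g' s ∧ ‖g'‖ ≤ C) :
    ‖g b - g a‖ ≤ C * (b - a) := by
  obtain ⟨φ, hφ, hφg⟩ := exists_dual_vector'' ℝ (g b - g a)
  have hac : AbsolutelyContinuousOnInterval (fun s => φ (g s)) a b := by
    rw [← uIcc_of_le hab] at hg
    exact (φ.lipschitz.comp_lipschitzOnWith hg).absolutelyContinuousOnInterval
  have hbound : ∀ᵐ s, s ∈ uIoc a b → ‖deriv (fun s => φ (g s)) s‖ ≤ C := by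
    filter_upwards [hg'] with s hs hsab
    rw [uIoc_of_le hab] at hsab
    obtain ⟨g', hder, hle⟩ := hs (Ioc_subset_Icc_self hsab)
    have hφder : HasDerivAt (fun s => φ (g s)) (φ g') s := φ.hasFDerivAt.comp_hasDerivAt s hder
    rw [hφder.deriv]
    calc ‖φ g'‖ ≤ 1 * ‖g'‖ := φ.le_of_opNorm_le hφ g'
      _ ≤ C := by rwa [one_mul]
  have hint := intervalIntegral.norm_integral_le_of_norm_le_const_ae hbound
  rw [hac.integral_deriv_eq_sub, ← map_sub, hφg, abs_of_nonneg (sub_nonneg.2 hab)] at hint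
  simpa using hint

/-- A function that is Lipschitz with some constant on a convex open set is Lipschitz there with any
constant that bounds the norm of its derivative almost everywhere. -/
theorem norm_sub_le_of_ae_hasFDerivAt_norm_le {E F : Type*} [NormedAddCommGroup E]
    [NormedSpace ℝ E] [FiniteDimensional ℝ E] [MeasurableSpace E] [BorelSpace E]
    (μ : Measure E) [μ.IsAddHaarMeasure] [NormedAddCommGroup F] [NormedSpace ℝ F]
    {f : E → F} {U : Set E} {C : ℝ} {K : NNReal} (hU : IsOpen U) (hUc : Convex ℝ U)
    (hf : LipschitzOnWith K f U)
    (hf' : ∀ᵐ y ∂μ, y ∈ U → ∃ f' : E →L[ℝ] F, HasFDerivAt f f' y ∧ ‖f'‖ ≤ C)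
    {y z : E} (hy : y ∈ U) (hz : z ∈ U) : ‖f z - f y‖ ≤ C * ‖z - y‖ := by
  obtain ⟨w, rfl⟩ : ∃ w, z = y + w := ⟨z - y, by simp⟩
  have hline : ∀ᵐ u ∂μ, ∀ᵐ s : ℝ, u + s • w ∈ U →
      ∃ f' : E →L[ℝ] F, HasFDerivAt f f' (u + s • w) ∧ ‖f'‖ ≤ C := by
    obtain ⟨N, hN, hNm, hN0⟩ := exists_measurable_superset_of_null (ae_iff.1 hf')
    have hae := (ae_ae_add_linearMap_mem_iff (LinearMap.toSpanSingleton ℝ E w) volume μ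
      hNm.compl).2 (compl_mem_ae_iff.2 hN0)
    filter_upwards [hae] with u hu
    filter_upwards [hu] with s hs
    by_contra h
    exact hs (hN h)
  have hmain : ∀ᵐ u ∂μ, u ∈ U → u + w ∈ U → ‖f (u + w) - f u‖ ≤ C * ‖w‖ := by
    filter_upwards [hline] with u hu hu0 hu1
    have hseg : ∀ s ∈ Icc (0 : ℝ) 1, u + s • w ∈ U := fun s hs =>
      hUc.add_smul_mem hu0 hu1 hs
    have hlip : LipschitzWith ‖w‖₊ (fun s : ℝ => u + s • w) := by
      refine LipschitzWith.of_dist_le_mul fun s t => ?_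
      rw [dist_add_left, dist_eq_norm, ← sub_smul, norm_smul, mul_comm, dist_eq_norm, coe_nnnorm]
    have := norm_sub_le_of_ae_hasDerivAt_norm_le (g := fun s : ℝ => f (u + s • w)) (C := C * ‖w‖)
      zero_le_one (hf.comp (hlip.lipschitzOnWith (s := Icc 0 1)) hseg) (by
        filter_upwards [hu] with s hs hs01
        obtain ⟨f', hder, hle⟩ := hs (hseg s hs01)
        have hc : HasDerivAt (fun s : ℝ => u + s • w) w s := by
          simpa using ((hasDerivAt_id s).smul_const w).const_add u
        exact ⟨f' w, hder.comp_hasDerivAt s hc, f'.le_of_opNorm_le hle w⟩)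
    simpa using this
  have hfreq : ∃ᶠ u in 𝓝 y, ‖f (u + w) - f u‖ ≤ C * ‖w‖ := by
    have hev : ∀ᶠ u in 𝓝 y, u ∈ U ∧ u + w ∈ U :=
      (hU.eventually_mem hy).and
        ((continuous_add_const w).continuousAt.eventually (hU.eventually_mem hz))
    refine ((mem_closure_iff_frequently.1 (Measure.dense_of_ae hmain y)).and_eventually hev).mono ?_
    exact fun u hu => hu.1 hu.2.1 hu.2.2
  have hcont : Tendsto (fun u => ‖f (u + w) - f u‖) (𝓝 y) (𝓝 ‖f (y + w) - f y‖) := by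
    have h0 : ContinuousAt f y := hf.continuousOn.continuousAt (hU.mem_nhds hy)
    have h1 : ContinuousAt f (y + w) := hf.continuousOn.continuousAt (hU.mem_nhds hz)
    have h2 : ContinuousAt (fun u => f (u + w)) y :=
      ContinuousAt.comp (f := fun u => u + w) h1 (by fun_prop)
    exact (h2.sub h0).norm
  simpa using le_of_tendsto_of_frequently hcont hfreq

/-- A function that is Lipschitz near `x` and whose derivative tends to `L` at `x` along its
differentiability set is strictly differentiable at `x`. -/
theorem hasStrictFDerivAt_of_lipschitzOnWith_of_tendsto_fderiv {E F : Type*}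
    [NormedAddCommGroup E] [NormedSpace ℝ E] [FiniteDimensional ℝ E]
    [NormedAddCommGroup F] [NormedSpace ℝ F] [FiniteDimensional ℝ F]
    {f : E → F} {L : E →L[ℝ] F} {x : E} {U : Set E} {K : NNReal} (hU : U ∈ 𝓝 x)
    (hf : LipschitzOnWith K f U)
    (hL : Tendsto (fderiv ℝ f) (𝓝[{y | DifferentiableAt ℝ f y}] x) (𝓝 L)) :
    HasStrictFDerivAt f L x := by
  borelize E
  rw [hasStrictFDerivAt_iff_isLittleO, Asymptotics.isLittleO_iff]
  intro ε hε
  have hclose : ∀ᶠ y in 𝓝 x, DifferentiableAt ℝ f y → ‖fderiv ℝ f y - L‖ ≤ ε := by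
    refine eventually_nhdsWithin_iff.1 ?_
    filter_upwards [hL (closedBall_mem_nhds L hε)] with y hy
    simpa [dist_eq_norm] using hy
  obtain ⟨r, hr, hball⟩ := Metric.eventually_nhds_iff_ball.1 (hclose.and hU)
  have hfr : LipschitzOnWith K f (ball x r) := hf.mono fun y hy => (hball y hy).2
  have hsub : LipschitzOnWith (K + ‖L‖₊) (fun y => f y - L y) (ball x r) :=
    hfr.sub L.lipschitz.lipschitzOnWith
  have hae : ∀ᵐ y ∂Measure.addHaar, y ∈ ball x r →
      ∃ f' : E →L[ℝ] F, HasFDerivAt (fun y => f y - L y) f' y ∧ ‖f'‖ ≤ ε := by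
    filter_upwards [hfr.ae_differentiableWithinAt_of_mem (μ := Measure.addHaar)] with y hy hyr
    have hd := (hy hyr).differentiableAt (isOpen_ball.mem_nhds hyr)
    exact ⟨_, hd.hasFDerivAt.sub L.hasFDerivAt, (hball y hyr).1 hd⟩
  have hx : ball x r ×ˢ ball x r ∈ 𝓝 (x, x) :=
    prod_mem_nhds (ball_mem_nhds x hr) (ball_mem_nhds x hr)
  filter_upwards [hx] with p hp
  have := norm_sub_le_of_ae_hasFDerivAt_norm_le Measure.addHaar isOpen_ball (convex_ball x r)
    hsub hae hp.2 hp.1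
  rwa [sub_sub_sub_comm, ← map_sub] at this

/-- Difference quotients at a point of strict differentiability converge uniformly in the base
point. -/
theorem HasStrictFDerivAt.tendsto_inv_smul_sub {E F : Type*}
    [NormedAddCommGroup E] [NormedSpace ℝ E] [NormedAddCommGroup F] [NormedSpace ℝ F]
    {f : E → F} {L : E →L[ℝ] F} {x : E} (hf : HasStrictFDerivAt f L x) (v : E) :
    Tendsto (fun p : E × ℝ => p.2⁻¹ • (f (p.1 + p.2 • v) - f p.1))
      (𝓝 x ×ˢ 𝓝[≠] (0 : ℝ)) (𝓝 (L v)) := by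
  have hfst : Tendsto Prod.fst (𝓝 x ×ˢ 𝓝[≠] (0 : ℝ)) (𝓝 x) := tendsto_fst
  have hsnd : Tendsto Prod.snd (𝓝 x ×ˢ 𝓝[≠] (0 : ℝ)) (𝓝 0) :=
    tendsto_snd.mono_right nhdsWithin_le_nhds
  have hpair : Tendsto (fun p : E × ℝ => (p.1 + p.2 • v, p.1)) (𝓝 x ×ˢ 𝓝[≠] (0 : ℝ))
      (𝓝 (x, x)) := by
    rw [nhds_prod_eq]
    refine Tendsto.prodMk ?_ hfst
    simpa using hfst.add (hsnd.smul_const v)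
  have ho : (fun p : E × ℝ => f (p.1 + p.2 • v) - f p.1 - p.2 • L v)
      =o[𝓝 x ×ˢ 𝓝[≠] (0 : ℝ)] fun p => p.2 := by
    have h := hf.isLittleO.comp_tendsto hpair
    simp only [Function.comp_def, add_sub_cancel_left, map_smul] at h
    refine h.trans_isBigO (Asymptotics.IsBigO.of_bound ‖v‖ (Eventually.of_forall fun p => ?_))
    rw [norm_smul, mul_comm]
  have hne : ∀ᶠ p : E × ℝ in 𝓝 x ×ˢ 𝓝[≠] (0 : ℝ), p.2 ≠ 0 :=
    tendsto_snd.eventually self_mem_nhdsWithin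
  rw [tendsto_iff_norm_sub_tendsto_zero]
  refine ho.norm_norm.tendsto_div_nhds_zero.congr' ?_
  filter_upwards [hne] with p hp
  have : p.2⁻¹ • (f (p.1 + p.2 • v) - f p.1) - L v =
      p.2⁻¹ • (f (p.1 + p.2 • v) - f p.1 - p.2 • L v) := by
    rw [smul_sub p.2⁻¹ _ (p.2 • L v), inv_smul_smul₀ hp]
  rw [this, norm_smul, norm_inv, div_eq_inv_mul]

theorem stmt19 {n m : ℕ} (hn : 1 ≤ n) (Ω : Set (Eucl n)) (hΩ : IsOpen Ω)
    (x : Eucl n) (hx : x ∈ Ω)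
    (F : Eucl n → Eucl m)
    (hF : ∃ U ∈ 𝓝 x, ∃ K : NNReal, LipschitzOnWith K F U)
    (L : Eucl n →L[ℝ] Eucl m)
    (hconv : Tendsto (fun y => fderiv ℝ F y)
      (𝓝[{y | DifferentiableAt ℝ F y}] x) (𝓝 L)) :
    ∀ v : Eucl n,
      Tendsto (fun p : Eucl n × ℝ => p.2⁻¹ • (F (p.1 + p.2 • v) - F p.1))
        ((𝓝 x) ×ˢ (𝓝[>] (0:ℝ))) (𝓝 (L v)) := by
  intro v
  obtain ⟨U, hU, K, hK⟩ := hF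
  exact ((hasStrictFDerivAt_of_lipschitzOnWith_of_tendsto_fderiv hU hK hconv).tendsto_inv_smul_sub
    v).mono_left (prod_mono_right _ (nhdsWithin_mono _ fun t ht => ne_of_gt ht))
end
end
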